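/- arXiv:1912.06855 — 11 statements merged into one kernel-verified Lean document; each statement's English description precedes it below -/
import Mathlib

section
/- For every g with 0 < g < 1/12 and all integers s, t ≥ 0, the quantity X_{s,t} satisfies the recurrence X_{s,t} = 1 + g·R_s·R_t·X_{s,t} + g²·R_s·R_t·R_{s+1}·R_{t+1}·X_{s,t}·X_{s+1,t+1}. -/
/-- `R = (1 - √(1 - 12g))/(6g)`. -/
noncomputable def Rgf (g : ℝ) : ℝ := (1 - Real.sqrt (1 - 12 * g)) / (6 * g)

/-- The two-point function `R_d` of quadrangulations. -/
noncomputable def Rd (g x : ℝ) (d : ℕ) : ℝ :=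
  Rgf g * ((1 - x ^ d) * (1 - x ^ (d + 3))) / ((1 - x ^ (d + 1)) * (1 - x ^ (d + 2)))

/-- The chain generating function `X_{s,t}`. -/
noncomputable def Xst (x : ℝ) (s t : ℕ) : ℝ :=
  ((1 - x ^ 3) * (1 - x ^ (s + 1)) * (1 - x ^ (t + 1)) * (1 - x ^ (s + t + 3))) /
    ((1 - x) * (1 - x ^ (s + 3)) * (1 - x ^ (t + 3)) * (1 - x ^ (s + t + 1)))

/-- `R` solves the quadratic equation `R = 1 + 3 g R ^ 2`. -/
lemma Rgf_eq_one_add {g : ℝ} (hg0 : 0 < g) (hg1 : g < 1 / 12) :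
    Rgf g = 1 + 3 * g * Rgf g ^ 2 := by
  have hsq : Real.sqrt (1 - 12 * g) ^ 2 = 1 - 12 * g := Real.sq_sqrt (by linarith)
  unfold Rgf
  field_simp
  linear_combination -3 * hsq

lemma Rgf_pos {g : ℝ} (hg0 : 0 < g) (hg1 : g < 1 / 12) : 0 < Rgf g := by
  nlinarith [Rgf_eq_one_add hg0 hg1, mul_nonneg hg0.le (sq_nonneg (Rgf g))]

/-- The weight `g R ^ 2` in terms of the root `x` of the characteristic equation. -/
lemma mul_Rgf_sq {g x : ℝ} (hg0 : 0 < g) (hg1 : g < 1 / 12) (hx0 : 0 < x)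
    (hroot : x + 1 / x = (1 - 4 * g * Rgf g) / (g * Rgf g)) :
    g * Rgf g ^ 2 = x / (1 + x + x ^ 2) := by
  have hR := Rgf_pos hg0 hg1
  have hquad := Rgf_eq_one_add hg0 hg1
  field_simp at hroot
  rw [eq_div_iff (by positivity)]
  linear_combination Rgf g * hroot + x * hquad

/-- The recurrence as an identity of rational functions, with `a = x ^ s` and `b = x ^ t`. -/
lemma chain_recurrence_aux {x a b : ℝ}
    (ha2 : 1 - a * x ^ 2 ≠ 0) (hb2 : 1 - b * x ^ 2 ≠ 0) (ha3 : 1 - a * x ^ 3 ≠ 0)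
    (hb3 : 1 - b * x ^ 3 ≠ 0) (hab : 1 - a * b * x ≠ 0) :
    (1 + x + x ^ 2) * (1 - a * x) * (1 - b * x) * (1 - a * b * x ^ 3) /
        ((1 - a * x ^ 3) * (1 - b * x ^ 3) * (1 - a * b * x)) =
      1 + x * (1 - a) * (1 - b) * (1 - a * b * x ^ 3) /
          ((1 - a * x ^ 2) * (1 - b * x ^ 2) * (1 - a * b * x)) +
        x ^ 2 * (1 - a) * (1 - b) * (1 - a * x) * (1 - b * x) * (1 - a * b * x ^ 5) /
          ((1 - a * x ^ 2) * (1 - b * x ^ 2) * (1 - a * x ^ 3) * (1 - b * x ^ 3) *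
            (1 - a * b * x)) := by
  generalize hA2 : 1 - a * x ^ 2 = A2 at *
  generalize hB2 : 1 - b * x ^ 2 = B2 at *
  generalize hA3 : 1 - a * x ^ 3 = A3 at *
  generalize hB3 : 1 - b * x ^ 3 = B3 at *
  generalize hC : 1 - a * b * x = C at *
  field_simp
  subst hA2 hB2 hA3 hB3 hC
  ring

lemma linear_term_aux {g R x T a₀ a₁ a₂ a₃ b₀ b₁ b₂ b₃ c₁ c₃ : ℝ} (hk : g * R ^ 2 = x / T)
    (hT : T ≠ 0) (ha₁ : a₁ ≠ 0) (hb₁ : b₁ ≠ 0) (ha₂ : a₂ ≠ 0) (hb₂ : b₂ ≠ 0) (ha₃ : a₃ ≠ 0)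
    (hb₃ : b₃ ≠ 0) (hc₁ : c₁ ≠ 0) :
    g * (R * (a₀ * a₃ / (a₁ * a₂))) * (R * (b₀ * b₃ / (b₁ * b₂))) *
        (T * a₁ * b₁ * c₃ / (a₃ * b₃ * c₁)) =
      x * a₀ * b₀ * c₃ / (a₂ * b₂ * c₁) := by
  trans g * R ^ 2 * (T * a₀ * b₀ * c₃ / (a₂ * b₂ * c₁))
  · field_simp
  · rw [hk]
    field_simp

lemma quadratic_term_aux {g R x T a₀ a₁ a₂ a₃ a₄ b₀ b₁ b₂ b₃ b₄ c₁ c₃ c₅ : ℝ}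
    (hk : g * R ^ 2 = x / T) (hT : T ≠ 0) (ha₂ : a₂ ≠ 0) (hb₂ : b₂ ≠ 0) (ha₃ : a₃ ≠ 0)
    (hb₃ : b₃ ≠ 0) (ha₄ : a₄ ≠ 0) (hb₄ : b₄ ≠ 0) (hc₁ : c₁ ≠ 0) (hc₃ : c₃ ≠ 0) :
    g ^ 2 * (R ^ 2 * (a₀ * a₄ / a₂ ^ 2)) * (R ^ 2 * (b₀ * b₄ / b₂ ^ 2)) *
        (T * a₁ * b₁ * c₃ / (a₃ * b₃ * c₁) * (T * a₂ * b₂ * c₅ / (a₄ * b₄ * c₃))) =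
      x ^ 2 * a₀ * b₀ * a₁ * b₁ * c₅ / (a₂ * b₂ * a₃ * b₃ * c₁) := by
  trans (g * R ^ 2) ^ 2 * (T ^ 2 * a₀ * b₀ * a₁ * b₁ * c₅ / (a₂ * b₂ * a₃ * b₃ * c₁))
  · field_simp
  · rw [hk]
    field_simp

theorem Xst_recurrence (g x : ℝ) (hg0 : 0 < g) (hg1 : g < 1 / 12)
    (hx0 : 0 < x) (hx1 : x < 1)
    (hroot : x + 1 / x = (1 - 4 * g * Rgf g) / (g * Rgf g)) (s t : ℕ) :
    Xst x s t =
      1 + g * Rd g x s * Rd g x t * Xst x s t +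
        g ^ 2 * Rd g x s * Rd g x t * Xst x s t *
          Rd g x (s + 1) * Rd g x (t + 1) * Xst x (s + 1) (t + 1) := by
  have hk := mul_Rgf_sq hg0 hg1 hx0 hroot
  have h3 : 1 + x + x ^ 2 ≠ 0 := by positivity
  have h1 : 1 - x ≠ 0 := by linarith
  have hpow (n m : ℕ) (hm : m ≠ 0) : 1 - x ^ n * x ^ m ≠ 0 := by
    rw [← pow_add]
    exact (sub_pos.2 (pow_lt_one₀ hx0.le hx1 (by omega))).ne'
  have ha1 : 1 - x ^ s * x ≠ 0 := by simpa using hpow s 1 one_ne_zero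
  have hb1 : 1 - x ^ t * x ≠ 0 := by simpa using hpow t 1 one_ne_zero
  have ha2 := hpow s 2 two_ne_zero
  have hb2 := hpow t 2 two_ne_zero
  have ha3 := hpow s 3 three_ne_zero
  have hb3 := hpow t 3 three_ne_zero
  have ha4 := hpow s 4 four_ne_zero
  have hb4 := hpow t 4 four_ne_zero
  have hab : 1 - x ^ s * x ^ t * x ≠ 0 := by
    simpa [pow_add] using hpow (s + t) 1 one_ne_zero
  have hab3 : 1 - x ^ s * x ^ t * x ^ 3 ≠ 0 := by
    simpa [pow_add] using hpow (s + t) 3 three_ne_zero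
  have hX : Xst x s t = (1 + x + x ^ 2) * (1 - x ^ s * x) * (1 - x ^ t * x) *
      (1 - x ^ s * x ^ t * x ^ 3) /
        ((1 - x ^ s * x ^ 3) * (1 - x ^ t * x ^ 3) * (1 - x ^ s * x ^ t * x)) := by
    simp only [Xst, pow_add, pow_one]
    field_simp
    ring
  have hX' : Xst x (s + 1) (t + 1) =
      (1 + x + x ^ 2) * (1 - x ^ s * x ^ 2) * (1 - x ^ t * x ^ 2) *
      (1 - x ^ s * x ^ t * x ^ 5) /
        ((1 - x ^ s * x ^ 4) * (1 - x ^ t * x ^ 4) * (1 - x ^ s * x ^ t * x ^ 3)) := by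
    have e1 : x ^ (s + 1 + 1) = x ^ s * x ^ 2 := by ring
    have e2 : x ^ (t + 1 + 1) = x ^ t * x ^ 2 := by ring
    have e3 : x ^ (s + 1 + 3) = x ^ s * x ^ 4 := by ring
    have e4 : x ^ (t + 1 + 3) = x ^ t * x ^ 4 := by ring
    have e5 : x ^ (s + 1 + (t + 1) + 3) = x ^ s * x ^ t * x ^ 5 := by ring
    have e6 : x ^ (s + 1 + (t + 1) + 1) = x ^ s * x ^ t * x ^ 3 := by ring
    simp only [Xst, e1, e2, e3, e4, e5, e6]
    field_simp
    ring
  have hR (d : ℕ) : Rd g x d = Rgf g * ((1 - x ^ d) * (1 - x ^ d * x ^ 3) /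
      ((1 - x ^ d * x) * (1 - x ^ d * x ^ 2))) := by
    simp only [Rd, pow_add, pow_one, mul_div_assoc]
  have hRR (d : ℕ) : Rd g x d * Rd g x (d + 1) = Rgf g ^ 2 *
      ((1 - x ^ d) * (1 - x ^ d * x ^ 4) / (1 - x ^ d * x ^ 2) ^ 2) := by
    have e1 : 1 - x ^ d * x ≠ 0 := by simpa using hpow d 1 one_ne_zero
    have e2 := hpow d 2 two_ne_zero
    have e3 := hpow d 3 three_ne_zero
    have e4 : x ^ (d + 1) = x ^ d * x := pow_succ x d
    have e5 : x ^ d * x * x = x ^ d * x ^ 2 := by ring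
    have e6 : x ^ d * x * x ^ 2 = x ^ d * x ^ 3 := by ring
    have e7 : x ^ d * x * x ^ 3 = x ^ d * x ^ 4 := by ring
    rw [hR, hR, e4, e5, e6, e7]
    field_simp
  have hlin : g * Rd g x s * Rd g x t * Xst x s t =
      x * (1 - x ^ s) * (1 - x ^ t) * (1 - x ^ s * x ^ t * x ^ 3) /
        ((1 - x ^ s * x ^ 2) * (1 - x ^ t * x ^ 2) * (1 - x ^ s * x ^ t * x)) := by
    rw [hR, hR, hX]
    exact linear_term_aux hk h3 ha1 hb1 ha2 hb2 ha3 hb3 hab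
  have hquad : g ^ 2 * Rd g x s * Rd g x t * Xst x s t *
      Rd g x (s + 1) * Rd g x (t + 1) * Xst x (s + 1) (t + 1) =
      x ^ 2 * (1 - x ^ s) * (1 - x ^ t) * (1 - x ^ s * x) * (1 - x ^ t * x) *
        (1 - x ^ s * x ^ t * x ^ 5) /
          ((1 - x ^ s * x ^ 2) * (1 - x ^ t * x ^ 2) * (1 - x ^ s * x ^ 3) *
            (1 - x ^ t * x ^ 3) * (1 - x ^ s * x ^ t * x)) := by
    trans g ^ 2 * (Rd g x s * Rd g x (s + 1)) * (Rd g x t * Rd g x (t + 1)) *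
      (Xst x s t * Xst x (s + 1) (t + 1))
    · ring
    rw [hRR, hRR, hX, hX']
    exact quadratic_term_aux hk h3 ha2 hb2 ha3 hb3 ha4 hb4 hab hab3
  rw [hlin, hquad, hX]
  exact chain_recurrence_aux ha2 hb2 ha3 hb3 hab
end

section
/- Fix Λ > 0 and S, T, U > 0. For ε > 0 small, let g = (1 − Λε)/12, R = (1 − √(Λε))/(6g), let x ∈ (0,1) be the root of x + 1/x = (1 − 4gR)/(gR), and set s = ⌊S ε^{−1/4}⌋, t = ⌊T ε^{−1/4}⌋, u = ⌊U ε^{−1/4}⌋. Then lim_{ε→0⁺} √ε · F_{s,t,u} = 𝓕(S,T,U; √(3/2)·Λ^{1/4}), where 𝓕(S,T,U;α) = (3/α²)·( sinh(αS) sinh(αT) sinh(αU) sinh(α(S+T+U)) / ( sinh(α(S+T)) sinh(α(T+U)) sinh(α(U+S)) ) )². -/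
open Filter

/-- The `Y`-diagram generating function `Y_{s,t,u}`. -/
noncomputable def Ystu (x : ℝ) (s t u : ℕ) : ℝ :=
  ((1 - x ^ (s + 3)) * (1 - x ^ (t + 3)) * (1 - x ^ (u + 3)) * (1 - x ^ (s + t + u + 3))) /
    ((1 - x ^ 3) * (1 - x ^ (s + t + 3)) * (1 - x ^ (t + u + 3)) * (1 - x ^ (u + s + 3)))

/-- The cumulative three-point function `F_{s,t,u}`. -/
noncomputable def Fstu (x : ℝ) (s t u : ℕ) : ℝ :=
  Xst x s t * Xst x t u * Xst x u s * (Ystu x s t u) ^ 2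

/-- The continuum three-point function `𝓕(S,T,U;α)`. -/
noncomputable def calF (S T U α : ℝ) : ℝ :=
  (3 / α ^ 2) *
    ((Real.sinh (α * S) * Real.sinh (α * T) * Real.sinh (α * U) *
        Real.sinh (α * (S + T + U))) /
      (Real.sinh (α * (S + T)) * Real.sinh (α * (T + U)) * Real.sinh (α * (U + S)))) ^ 2

open Topology

theorem tendsto_one_sub_pow_add {ι : Type*} {l : Filter ι} {x : ι → ℝ} {n : ι → ℕ} {p : ℝ}
    (hx : Tendsto x l (𝓝 1)) (hn : Tendsto (fun i => x i ^ n i) l (𝓝 p)) (k : ℕ) :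
    Tendsto (fun i => 1 - x i ^ (n i + k)) l (𝓝 (1 - p)) := by
  simpa [pow_add] using (hn.mul (hx.pow k)).const_sub 1

theorem tendsto_pow_add {ι : Type*} {l : Filter ι} {x : ι → ℝ} {m n : ι → ℕ} {p q : ℝ}
    (hm : Tendsto (fun i => x i ^ m i) l (𝓝 p)) (hn : Tendsto (fun i => x i ^ n i) l (𝓝 q)) :
    Tendsto (fun i => x i ^ (m i + n i)) l (𝓝 (p * q)) := by
  simpa [pow_add] using hm.mul hn

theorem tendsto_one_sub_cube_div {ι : Type*} {l : Filter ι} {x : ι → ℝ}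
    (hx : Tendsto x l (𝓝 1)) (hx1 : ∀ᶠ i in l, x i < 1) :
    Tendsto (fun i => (1 - x i ^ 3) / (1 - x i)) l (𝓝 3) := by
  have h : Tendsto (fun i => 1 + x i + x i ^ 2) l (𝓝 (1 + 1 + 1 ^ 2)) :=
    (hx.const_add 1).add (hx.pow 2)
  norm_num at h
  refine h.congr' ?_
  filter_upwards [hx1] with i hi
  have : 1 - x i ≠ 0 := by linarith
  field_simp
  ring

theorem Xst_tendsto {ι : Type*} {l : Filter ι} {x : ι → ℝ} {s t : ι → ℕ} {p q : ℝ}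
    (hx : Tendsto x l (𝓝 1)) (hx1 : ∀ᶠ i in l, x i < 1)
    (hs : Tendsto (fun i => x i ^ s i) l (𝓝 p)) (ht : Tendsto (fun i => x i ^ t i) l (𝓝 q))
    (hp : 1 - p ≠ 0) (hq : 1 - q ≠ 0) (hpq : 1 - p * q ≠ 0) :
    Tendsto (fun i => Xst (x i) (s i) (t i)) l (𝓝 3) := by
  have hst := tendsto_pow_add hs ht
  have h := (tendsto_one_sub_cube_div hx hx1).mul
    ((((tendsto_one_sub_pow_add hx hs 1).mul (tendsto_one_sub_pow_add hx ht 1)).mul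
      (tendsto_one_sub_pow_add hx hst 3)).div
    (((tendsto_one_sub_pow_add hx hs 3).mul (tendsto_one_sub_pow_add hx ht 3)).mul
      (tendsto_one_sub_pow_add hx hst 1)) (by positivity))
  rw [div_self (by positivity), mul_one] at h
  refine h.congr fun i => ?_
  rw [Xst, Pi.div_apply, div_mul_div_comm]
  simp only [mul_assoc]

theorem one_sub_cube_mul_Ystu_tendsto {ι : Type*} {l : Filter ι} {x : ι → ℝ} {s t u : ι → ℕ}
    {p q r : ℝ} (hx : Tendsto x l (𝓝 1)) (hx1 : ∀ᶠ i in l, x i < 1)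
    (hs : Tendsto (fun i => x i ^ s i) l (𝓝 p)) (ht : Tendsto (fun i => x i ^ t i) l (𝓝 q))
    (hu : Tendsto (fun i => x i ^ u i) l (𝓝 r))
    (hpq : 1 - p * q ≠ 0) (hqr : 1 - q * r ≠ 0) (hrp : 1 - r * p ≠ 0) :
    Tendsto (fun i => (1 - x i ^ 3) * Ystu (x i) (s i) (t i) (u i)) l
      (𝓝 ((1 - p) * (1 - q) * (1 - r) * (1 - p * q * r) /
        ((1 - p * q) * (1 - q * r) * (1 - r * p)))) := by
  have hst := tendsto_pow_add hs ht
  have h := ((((tendsto_one_sub_pow_add hx hs 3).mul (tendsto_one_sub_pow_add hx ht 3)).mul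
      (tendsto_one_sub_pow_add hx hu 3)).mul
      (tendsto_one_sub_pow_add hx (tendsto_pow_add hst hu) 3)).div
    (((tendsto_one_sub_pow_add hx hst 3).mul
      (tendsto_one_sub_pow_add hx (tendsto_pow_add ht hu) 3)).mul
      (tendsto_one_sub_pow_add hx (tendsto_pow_add hu hs) 3)) (by positivity)
  refine h.congr' ?_
  filter_upwards [hx1, hx.eventually (lt_mem_nhds zero_lt_one)] with i hi hi0
  have h3 : 1 - x i ^ 3 ≠ 0 := (sub_pos.2 (pow_lt_one₀ hi0.le hi (by norm_num))).ne'
  rw [Ystu, Pi.div_apply, ← mul_div_assoc]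
  simp only [mul_assoc]
  rw [mul_div_mul_left _ _ h3]

/-- If `x → 1` with `(1 - x) c → A` and `n / c → N`, then `xⁿ → exp (-A N)`. -/
theorem tendsto_pow_exp {ι : Type*} {l : Filter ι} {x c : ι → ℝ} {n : ι → ℕ} {A N : ℝ}
    (hx : Tendsto x l (𝓝 1)) (hx1 : ∀ᶠ i in l, x i < 1) (hc : ∀ᶠ i in l, 0 < c i)
    (hA : Tendsto (fun i => (1 - x i) * c i) l (𝓝 A))
    (hN : Tendsto (fun i => (n i : ℝ) / c i) l (𝓝 N)) :
    Tendsto (fun i => x i ^ n i) l (𝓝 (Real.exp (-(A * N)))) := by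
  have hx' : Tendsto x l (𝓝[≠] 1) :=
    tendsto_nhdsWithin_iff.2 ⟨hx, hx1.mono fun i hi => hi.ne⟩
  have hlog := (hasDerivAt_iff_tendsto_slope.1 (Real.hasDerivAt_log one_ne_zero)).comp hx'
  have h := (Real.continuous_exp.tendsto _).comp ((hlog.mul (hA.mul hN)).neg)
  rw [inv_one, one_mul] at h
  refine h.congr' ?_
  filter_upwards [hx1, hc, hx.eventually (lt_mem_nhds zero_lt_one)] with i hi hci hi0
  have h1 : x i - 1 ≠ 0 := by linarith
  have hlogpow : x i ^ n i = Real.exp (n i * Real.log (x i)) := by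
    rw [Real.exp_nat_mul, Real.exp_log hi0]
  rw [hlogpow]
  simp only [Function.comp_apply, slope_def_field, Real.log_one]
  congr 1
  field_simp
  ring

theorem one_sub_exp_neg_two_mul (z : ℝ) :
    1 - Real.exp (-(2 * z)) = 2 * Real.exp (-z) * Real.sinh z := by
  have h1 : Real.exp (-z) * Real.exp z = 1 := by rw [← Real.exp_add]; simp
  have h2 : Real.exp (-(2 * z)) = Real.exp (-z) * Real.exp (-z) := by
    rw [← Real.exp_add]; ring_nf
  rw [Real.sinh_eq, h2]
  linear_combination -h1

theorem sq_one_sub_div_of_add_inv {x δ : ℝ} (hx : 0 < x) (hδ : δ < 1) (hδ' : -1 < δ)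
    (h : x + 1 / x = (1 - 4 * ((1 - δ ^ 2) / 12) * ((1 - δ) / (6 * ((1 - δ ^ 2) / 12)))) /
      (((1 - δ ^ 2) / 12) * ((1 - δ) / (6 * ((1 - δ ^ 2) / 12))))) :
    (1 - x) ^ 2 = x * (6 * δ / (1 - δ)) := by
  have h1 : 1 - δ ≠ 0 := by linarith
  have h2 : 1 - δ ^ 2 ≠ 0 := by nlinarith
  have h3 : (1 - δ ^ 2) / 12 * ((1 - δ) / (6 * ((1 - δ ^ 2) / 12))) = (1 - δ) / 6 := by
    field_simp
  rw [mul_assoc 4, h3] at h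
  field_simp at h ⊢
  linear_combination h

theorem tendsto_rpow_neg_quarter :
    Tendsto (fun ε : ℝ => ε ^ (-(1 / 4 : ℝ))) (𝓝[>] 0) atTop :=
  tendsto_rpow_neg_nhdsGT_zero (by norm_num)

theorem sqrt_mul_rpow_neg_quarter_sq {ε : ℝ} (hε : 0 < ε) :
    √ε * (ε ^ (-(1 / 4 : ℝ))) ^ 2 = 1 := by
  rw [Real.sqrt_eq_rpow, ← Real.rpow_natCast, ← Real.rpow_mul hε.le, ← Real.rpow_add hε]
  norm_num

theorem sqrt_three_halves_mul_rpow_quarter_sq {Λ : ℝ} (hΛ : 0 < Λ) :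
    (√(3 / 2) * Λ ^ ((1 : ℝ) / 4)) ^ 2 = 3 / 2 * √Λ := by
  rw [mul_pow, Real.sq_sqrt (by norm_num), Real.sqrt_eq_rpow, ← Real.rpow_natCast,
    ← Real.rpow_mul hΛ.le]
  norm_num

/-- The limit obtained from the generating functions agrees with `calF`. -/
theorem calF_eq_exp {S T U α : ℝ} (hα : 0 < α) (hS : 0 < S) (hT : 0 < T) (hU : 0 < U) :
    let p := Real.exp (-(2 * α * S))
    let q := Real.exp (-(2 * α * T))
    let r := Real.exp (-(2 * α * U))
    3 * 3 * 3 * ((1 - p) * (1 - q) * (1 - r) * (1 - p * q * r) /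
        ((1 - p * q) * (1 - q * r) * (1 - r * p))) ^ 2 * (1 / (3 * (2 * α)) ^ 2) =
      calF S T U α := by
  intro p q r
  have key (V : ℝ) : 1 - Real.exp (-(2 * α * V)) =
      2 * Real.exp (-(α * V)) * Real.sinh (α * V) := by
    rw [← one_sub_exp_neg_two_mul, mul_assoc]
  have hadd (V W : ℝ) : Real.exp (-(2 * α * V)) * Real.exp (-(2 * α * W)) =
      Real.exp (-(2 * α * (V + W))) := by
    rw [← Real.exp_add]; ring_nf
  have hsplit (V W : ℝ) : Real.exp (-(α * (V + W))) =
      Real.exp (-(α * V)) * Real.exp (-(α * W)) := by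
    rw [← Real.exp_add]; ring_nf
  have hsinh {V : ℝ} (hV : 0 < V) : Real.sinh (α * V) ≠ 0 :=
    (Real.sinh_pos_iff.2 (mul_pos hα hV)).ne'
  have h1 := hsinh (add_pos hS hT)
  have h2 := hsinh (add_pos hT hU)
  have h3 := hsinh (add_pos hU hS)
  simp only [p, q, r, hadd, key, hsplit, calF]
  field_simp

theorem tendsto_sqrt_mul_nhdsGT_zero (Λ : ℝ) :
    Tendsto (fun ε : ℝ => √(Λ * ε)) (𝓝[>] 0) (𝓝 0) := by
  have : Continuous fun ε : ℝ => √(Λ * ε) := by fun_prop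
  simpa using (this.tendsto 0).mono_left nhdsWithin_le_nhds

theorem tendsto_one_of_sq {Λ : ℝ} {x : ℝ → ℝ} (hx : ∀ᶠ ε in 𝓝[>] 0, x ε ∈ Set.Ioo (0 : ℝ) 1)
    (hsq : ∀ᶠ ε in 𝓝[>] 0, (1 - x ε) ^ 2 = x ε * (6 * √(Λ * ε) / (1 - √(Λ * ε)))) :
    Tendsto x (𝓝[>] 0) (𝓝 1) := by
  have hδ := tendsto_sqrt_mul_nhdsGT_zero Λ
  have hb : Tendsto (fun ε : ℝ => 6 * √(Λ * ε) / (1 - √(Λ * ε))) (𝓝[>] 0) (𝓝 0) := by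
    simpa [Pi.div_def] using (hδ.const_mul 6).div (hδ.const_sub 1) (by norm_num)
  have h2 : Tendsto (fun ε => (1 - x ε) ^ 2) (𝓝[>] 0) (𝓝 0) := by
    refine squeeze_zero' (Eventually.of_forall fun ε => sq_nonneg _) ?_ hb
    filter_upwards [hx, hsq, hδ.eventually (gt_mem_nhds zero_lt_one)] with ε h hs h1
    rw [hs]
    exact mul_le_of_le_one_left
      (div_nonneg (mul_nonneg (by norm_num) (Real.sqrt_nonneg _)) (by linarith)) h.2.le
  have h3 := (Real.continuous_sqrt.tendsto _).comp h2
  rw [Real.sqrt_zero] at h3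
  have h4 := h3.const_sub 1
  rw [sub_zero] at h4
  refine h4.congr' ?_
  filter_upwards [hx] with ε h
  simp only [Function.comp_apply]
  rw [Real.sqrt_sq (by linarith [h.2])]
  ring

theorem tendsto_one_sub_mul_rpow {Λ : ℝ} (hΛ : 0 < Λ) {x : ℝ → ℝ}
    (hx : ∀ᶠ ε in 𝓝[>] 0, x ε ∈ Set.Ioo (0 : ℝ) 1)
    (hsq : ∀ᶠ ε in 𝓝[>] 0, (1 - x ε) ^ 2 = x ε * (6 * √(Λ * ε) / (1 - √(Λ * ε)))) :
    Tendsto (fun ε => (1 - x ε) * ε ^ (-(1 / 4 : ℝ))) (𝓝[>] 0)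
      (𝓝 (2 * (√(3 / 2) * Λ ^ ((1 : ℝ) / 4)))) := by
  have hδ := tendsto_sqrt_mul_nhdsGT_zero Λ
  have h := (Real.continuous_sqrt.tendsto _).comp ((tendsto_one_of_sq hx hsq).mul
    ((tendsto_const_nhds (x := 6 * √Λ)).div (hδ.const_sub 1) (by norm_num)))
  have hlim : √(1 * (6 * √Λ / (1 - 0))) = 2 * (√(3 / 2) * Λ ^ ((1 : ℝ) / 4)) := by
    rw [Real.sqrt_eq_iff_mul_self_eq (by positivity) (by positivity)]
    linear_combination -4 * sqrt_three_halves_mul_rpow_quarter_sq hΛ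
  rw [hlim] at h
  refine h.congr' ?_
  filter_upwards [hx, hsq, self_mem_nhdsWithin] with ε h hs hε
  have hε : 0 < ε := hε
  simp only [Function.comp_apply, Pi.div_apply]
  have hc : 0 < ε ^ (-(1 / 4 : ℝ)) := by positivity
  have h0 : 0 ≤ (1 - x ε) * ε ^ (-(1 / 4 : ℝ)) := mul_nonneg (by linarith [h.2]) hc.le
  rw [← Real.sqrt_sq h0]
  congr 1
  rw [mul_pow, hs, Real.sqrt_mul hΛ.le]
  linear_combination (-(x ε * (6 * √Λ / (1 - √Λ * √ε)))) * sqrt_mul_rpow_neg_quarter_sq hε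

theorem Fstu_scaling_limit (Λ S T U : ℝ) (hΛ : 0 < Λ) (hS : 0 < S) (hT : 0 < T) (hU : 0 < U)
    (x : ℝ → ℝ) (ε₀ : ℝ) (hε₀ : 0 < ε₀)
    (hx : ∀ ε ∈ Set.Ioo (0 : ℝ) ε₀,
      x ε ∈ Set.Ioo (0 : ℝ) 1 ∧
        x ε + 1 / x ε =
          (1 - 4 * ((1 - Λ * ε) / 12) * ((1 - Real.sqrt (Λ * ε)) / (6 * ((1 - Λ * ε) / 12)))) /
            (((1 - Λ * ε) / 12) * ((1 - Real.sqrt (Λ * ε)) / (6 * ((1 - Λ * ε) / 12))))) :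
    Tendsto (fun ε : ℝ =>
        Real.sqrt ε *
          Fstu (x ε) (Nat.floor (S * ε ^ (-(1 / 4 : ℝ)))) (Nat.floor (T * ε ^ (-(1 / 4 : ℝ))))
            (Nat.floor (U * ε ^ (-(1 / 4 : ℝ)))))
      (nhdsWithin 0 (Set.Ioi 0))
      (nhds (calF S T U (Real.sqrt (3 / 2) * Λ ^ ((1 : ℝ) / 4)))) := by
  set α := √(3 / 2) * Λ ^ ((1 : ℝ) / 4) with hαdef
  have hα : 0 < α := by positivity
  have hmem : ∀ᶠ ε in 𝓝[>] (0 : ℝ), ε ∈ Set.Ioo (0 : ℝ) ε₀ := Ioo_mem_nhdsGT hε₀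
  have hx01 : ∀ᶠ ε in 𝓝[>] 0, x ε ∈ Set.Ioo (0 : ℝ) 1 := hmem.mono fun ε hε => (hx ε hε).1
  have hx1 : ∀ᶠ ε in 𝓝[>] 0, x ε < 1 := hx01.mono fun ε hε => hε.2
  have hsmall : ∀ᶠ ε in 𝓝[>] (0 : ℝ), ε ∈ Set.Ioo (0 : ℝ) Λ⁻¹ := Ioo_mem_nhdsGT (by positivity)
  have hsq : ∀ᶠ ε in 𝓝[>] 0, (1 - x ε) ^ 2 = x ε * (6 * √(Λ * ε) / (1 - √(Λ * ε))) := by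
    filter_upwards [hmem, hsmall] with ε hε hε'
    have h1 : √(Λ * ε) < 1 := by
      rw [Real.sqrt_lt' one_pos, one_pow]
      calc Λ * ε < Λ * Λ⁻¹ := mul_lt_mul_of_pos_left hε'.2 hΛ
        _ = 1 := mul_inv_cancel₀ hΛ.ne'
    refine sq_one_sub_div_of_add_inv (hx ε hε).1.1 h1
      (by linarith [Real.sqrt_nonneg (Λ * ε)]) ?_
    rw [Real.sq_sqrt (mul_nonneg hΛ.le hε.1.le)]
    exact (hx ε hε).2
  have hxt := tendsto_one_of_sq hx01 hsq
  have hA := tendsto_one_sub_mul_rpow hΛ hx01 hsq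
  rw [← hαdef] at hA
  have hpow {V : ℝ} (hV : 0 < V) :
      Tendsto (fun ε => x ε ^ ⌊V * ε ^ (-(1 / 4 : ℝ))⌋₊) (𝓝[>] 0)
        (𝓝 (Real.exp (-(2 * α * V)))) :=
    tendsto_pow_exp hxt hx1 (tendsto_rpow_neg_quarter.eventually_gt_atTop 0) hA
      ((tendsto_nat_floor_mul_div_atTop hV.le).comp tendsto_rpow_neg_quarter)
  have hne {V : ℝ} (hV : 0 < V) : 1 - Real.exp (-(2 * α * V)) ≠ 0 :=
    (sub_pos.2 (Real.exp_lt_one_iff.2 (neg_lt_zero.2 (by positivity)))).ne'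
  have hne2 {V W : ℝ} (hV : 0 < V) (hW : 0 < W) :
      1 - Real.exp (-(2 * α * V)) * Real.exp (-(2 * α * W)) ≠ 0 := by
    have := hne (add_pos hV hW)
    rwa [mul_add, neg_add, Real.exp_add] at this
  have hX {V W : ℝ} (hV : 0 < V) (hW : 0 < W) :=
    Xst_tendsto hxt hx1 (hpow hV) (hpow hW) (hne hV) (hne hW) (hne2 hV hW)
  have hY := one_sub_cube_mul_Ystu_tendsto hxt hx1 (hpow hS) (hpow hT) (hpow hU)
    (hne2 hS hT) (hne2 hT hU) (hne2 hU hS)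
  have hscale := (tendsto_const_nhds (x := (1 : ℝ))).div
    (((tendsto_one_sub_cube_div hxt hx1).mul hA).pow 2) (by positivity)
  have h := ((((hX hS hT).mul (hX hT hU)).mul (hX hU hS)).mul (hY.pow 2)).mul hscale
  rw [calF_eq_exp hα hS hT hU] at h
  refine h.congr' ?_
  filter_upwards [hx01, self_mem_nhdsWithin] with ε hxε hε
  have h1 : 1 - x ε ≠ 0 := (sub_pos.2 hxε.2).ne'
  have h3 : 1 - x ε ^ 3 ≠ 0 := (sub_pos.2 (pow_lt_one₀ hxε.1.le hxε.2 (by norm_num))).ne'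
  have hroot : √ε = 1 / (ε ^ (-(1 / 4 : ℝ))) ^ 2 :=
    eq_one_div_of_mul_eq_one_left (sqrt_mul_rpow_neg_quarter_sq hε)
  have hc : ε ^ (-(1 / 4 : ℝ)) ≠ 0 := (Real.rpow_pos_of_pos hε _).ne'
  rw [Fstu, hroot, Pi.div_apply]
  generalize ε ^ (-(1 / 4 : ℝ)) = c at *
  field_simp
end

section
/- For all nonnegative integers i, j, q one has Cat(i+j+q) = Σ_{h,h' ≥ 0} p(2i, 0, 2h)·p(2q, 2h, 2h')·p(2j, 2h', 0), and Cat(i+j+q+1) = Σ_{h,h' ≥ 0} p(2i+1, 0, 2h+1)·p(2q, 2h+1, 2h'+1)·p(2j+1, 2h'+1, 0); in both identities only finitely many terms are nonzero. -/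
/-- `C(ℓ, k/2)`, taken to be `0` unless `k` is even and `0 ≤ k/2 ≤ ℓ`. -/
def cHalf (l : ℕ) (k : ℤ) : ℤ :=
  if 2 ∣ k ∧ 0 ≤ k ∧ k / 2 ≤ (l : ℤ) then (l.choose (k / 2).toNat : ℤ) else 0

/-- `p(ℓ, a, b) = C(ℓ, (ℓ+a−b)/2) − C(ℓ, (ℓ+a+b+2)/2)`, the number of nonnegative
lattice paths of length `ℓ` from height `a` to height `b` with `±1` steps. -/
def pathP (l a b : ℕ) : ℤ :=
  cHalf l ((l : ℤ) + a - b) - cHalf l ((l : ℤ) + a + b + 2)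

theorem cHalf_zero (k : ℤ) : cHalf 0 k = if k = 0 then 1 else 0 := by
  unfold cHalf
  split_ifs with h₁ h₂ h₂
  · simp [h₂]
  · omega
  · omega
  · rfl

theorem cHalf_odd (l : ℕ) (k : ℤ) (hk : ¬ 2 ∣ k) : cHalf l k = 0 :=
  if_neg fun h => hk h.1

theorem cHalf_neg (l : ℕ) (k : ℤ) (hk : k < 0) : cHalf l k = 0 :=
  if_neg fun h => absurd h.2.1 (not_le.2 hk)

theorem cHalf_two_mul (l m : ℕ) : cHalf l (2 * (m : ℤ)) = l.choose m := by
  unfold cHalf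
  have h₁ : (2 * (m : ℤ)) / 2 = m := by omega
  rw [h₁, Int.toNat_natCast]
  split_ifs with h
  · rfl
  · rw [Nat.choose_eq_zero_of_lt (by omega), Nat.cast_zero]

theorem cHalf_eq_zero_of_lt (l : ℕ) (k : ℤ) (hk : 2 * (l : ℤ) < k) : cHalf l k = 0 :=
  if_neg fun h => by omega

theorem cHalf_succ (l : ℕ) (k : ℤ) : cHalf (l + 1) k = cHalf l k + cHalf l (k - 2) := by
  by_cases h2 : 2 ∣ k
  · rcases lt_or_ge k 0 with hk | hk
    · simp [cHalf_neg _ k hk, cHalf_neg _ (k - 2) (by omega)]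
    · obtain ⟨z, rfl⟩ := h2
      lift z to ℕ using by omega
      cases z with
      | zero =>
        rw [cHalf_two_mul, cHalf_two_mul, cHalf_neg _ _ (by simp)]
        simp
      | succ m =>
        have h : 2 * ((m + 1 : ℕ) : ℤ) - 2 = 2 * (m : ℤ) := by push_cast; ring
        rw [h, cHalf_two_mul, cHalf_two_mul, cHalf_two_mul, Nat.choose_succ_succ]
        push_cast
        ring
  · rw [cHalf_odd _ _ h2, cHalf_odd _ _ h2, cHalf_odd _ _ (by omega), add_zero]

theorem cHalf_symm (l : ℕ) {k k' : ℤ} (h : k + k' = 2 * l) : cHalf l k = cHalf l k' := by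
  by_cases h2 : 2 ∣ k
  · obtain ⟨z, rfl⟩ := h2
    obtain ⟨z', rfl⟩ : 2 ∣ k' := by omega
    rcases lt_or_ge z 0 with hz | hz
    · rw [cHalf_neg _ _ (by omega), cHalf_eq_zero_of_lt _ _ (by omega)]
    · rcases lt_or_ge z' 0 with hz' | hz'
      · rw [cHalf_eq_zero_of_lt _ _ (by omega), cHalf_neg _ _ (by omega)]
      · lift z to ℕ using hz
        lift z' to ℕ using hz'
        rw [cHalf_two_mul, cHalf_two_mul, Nat.choose_symm_of_eq_add (show l = z + z' by omega)]
  · rw [cHalf_odd _ _ h2, cHalf_odd _ _ (by omega)]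

theorem pathP_zero (a b : ℕ) : pathP 0 a b = if a = b then 1 else 0 := by
  unfold pathP
  rw [cHalf_zero, cHalf_zero]
  split_ifs <;> first | rfl | omega

theorem pathP_comm (l a b : ℕ) : pathP l a b = pathP l b a := by
  unfold pathP
  rw [cHalf_symm l (k := (l : ℤ) + a - b) (k' := (l : ℤ) + b - a) (by ring),
    add_right_comm (l : ℤ) a b]

theorem pathP_succ_zero (l a : ℕ) : pathP (l + 1) a 0 = pathP l a 1 := by
  unfold pathP
  rw [cHalf_succ, cHalf_succ]
  push_cast
  ring_nf

theorem pathP_succ_succ (l a b : ℕ) :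
    pathP (l + 1) a (b + 1) = pathP l a b + pathP l a (b + 2) := by
  unfold pathP
  rw [cHalf_succ, cHalf_succ]
  push_cast
  ring_nf

theorem pathP_eq_zero_of_lt {l a b : ℕ} (h : l + a < b) : pathP l a b = 0 := by
  unfold pathP
  rw [cHalf_neg _ _ (by omega), cHalf_eq_zero_of_lt _ _ (by omega), sub_zero]

theorem pathP_eq_zero_of_parity {l a b : ℕ} (h : (l + a) % 2 ≠ b % 2) : pathP l a b = 0 := by
  unfold pathP
  rw [cHalf_odd _ _ (by omega), cHalf_odd _ _ (by omega), sub_zero]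

theorem pathP_two_mul_zero_zero (n : ℕ) : pathP (2 * n) 0 0 = catalan n := by
  have h₁ : ((2 * n : ℕ) : ℤ) + (0 : ℕ) - (0 : ℕ) = 2 * (n : ℤ) := by push_cast; ring
  have h₂ : ((2 * n : ℕ) : ℤ) + (0 : ℕ) + (0 : ℕ) + 2 = 2 * ((n + 1 : ℕ) : ℤ) := by
    push_cast; ring
  rw [pathP, h₁, h₂, cHalf_two_mul, cHalf_two_mul]
  have hc : ((n : ℤ) + 1) * catalan n = (2 * n).choose n := by
    exact_mod_cast succ_mul_catalan_eq_centralBinom n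
  have hs : ((2 * n).choose (n + 1) : ℤ) * (n + 1) = (2 * n).choose n * n := by
    have := Nat.choose_succ_right_eq (2 * n) n
    rw [show 2 * n - n = n by omega] at this
    exact_mod_cast this
  have hn : (n : ℤ) + 1 ≠ 0 := by positivity
  apply mul_left_cancel₀ hn
  linear_combination -hs - hc

/-- Splitting paths of length `l + m` according to their height after `l` steps. -/
theorem pathP_add (l m a b N : ℕ) (hN : l + a < N) :
    pathP (l + m) a b = ∑ c ∈ Finset.range N, pathP l a c * pathP m c b := by
  induction m generalizing b with
  | zero =>
    simp only [pathP_zero, mul_ite, mul_one, mul_zero, Finset.sum_ite_eq', Finset.mem_range,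
      add_zero]
    split_ifs with h
    · rfl
    · exact pathP_eq_zero_of_lt (by omega)
  | succ m ih =>
    rw [← add_assoc]
    cases b with
    | zero => simp only [pathP_succ_zero, ih]
    | succ b => simp only [pathP_succ_succ, ih, mul_add, Finset.sum_add_distrib]

theorem finite_support_pathP (l a s : ℕ) :
    (Function.support fun h : ℕ => pathP l a (2 * h + s)).Finite :=
  (Set.finite_Iic (l + a)).subset fun h hh => by
    by_contra hlt
    exact hh (pathP_eq_zero_of_lt (by simp only [Set.mem_Iic] at hlt; omega))

theorem pathP_add_eq_finsum (l m a b s : ℕ) (hs : s < 2) (hp : (l + a) % 2 = s) :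
    pathP (l + m) a b = ∑ᶠ h : ℕ, pathP l a (2 * h + s) * pathP m (2 * h + s) b := by
  have hsplit : ∀ (f : ℕ → ℤ) (M : ℕ), (∀ c, c % 2 ≠ s → f c = 0) →
      ∑ c ∈ Finset.range (2 * M), f c = ∑ h ∈ Finset.range M, f (2 * h + s) := by
    intro f M hf
    induction M with
    | zero => simp
    | succ M ih =>
      rw [mul_add_one, Finset.sum_range_succ, Finset.sum_range_succ, Finset.sum_range_succ, ih,
        add_assoc]
      congr 1
      obtain rfl | rfl : s = 0 ∨ s = 1 := by omega
      · rw [hf (2 * M + 1) (by omega)]; simp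
      · rw [hf (2 * M) (by omega)]; simp
  rw [pathP_add l m a b (2 * (l + a + 1)) (by omega), hsplit, finsum_eq_sum_of_support_subset]
  · intro h hh
    by_contra hlt
    refine hh ?_
    have : l + a < 2 * h + s := by
      simp only [Finset.coe_range, Set.mem_Iio] at hlt
      omega
    simp [pathP_eq_zero_of_lt this]
  · intro c hc
    rw [pathP_eq_zero_of_parity (by omega), zero_mul]

theorem finite_support_pathP_mul_mul (l m n a b s : ℕ) :
    (Function.support fun p : ℕ × ℕ =>
      pathP l a (2 * p.1 + s) * pathP m (2 * p.1 + s) (2 * p.2 + s) *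
        pathP n (2 * p.2 + s) b).Finite :=
  ((finite_support_pathP l a s).prod (finite_support_pathP n b s)).subset fun p hp => by
    refine ⟨left_ne_zero_of_mul (left_ne_zero_of_mul hp), ?_⟩
    have := right_ne_zero_of_mul hp
    rwa [pathP_comm] at this

theorem pathP_add_add_eq_finsum (l m n a b s : ℕ) (hs : s < 2) (hl : (l + a) % 2 = s)
    (hm : m % 2 = 0) :
    pathP (l + (m + n)) a b = ∑ᶠ (h : ℕ) (h' : ℕ),
      pathP l a (2 * h + s) * pathP m (2 * h + s) (2 * h' + s) * pathP n (2 * h' + s) b := by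
  rw [pathP_add_eq_finsum l (m + n) a b s hs hl]
  refine finsum_congr fun h => ?_
  rw [pathP_add_eq_finsum m n (2 * h + s) b s hs (by omega), mul_finsum]
  simp only [mul_assoc]

theorem catalan_toeplitz_hankel (i j q : ℕ) :
    (Function.support (fun p : ℕ × ℕ =>
        pathP (2 * i) 0 (2 * p.1) * pathP (2 * q) (2 * p.1) (2 * p.2) *
          pathP (2 * j) (2 * p.2) 0)).Finite ∧
    (Function.support (fun p : ℕ × ℕ =>
        pathP (2 * i + 1) 0 (2 * p.1 + 1) * pathP (2 * q) (2 * p.1 + 1) (2 * p.2 + 1) *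
          pathP (2 * j + 1) (2 * p.2 + 1) 0)).Finite ∧
    (catalan (i + j + q) : ℤ) =
      (∑ᶠ (h : ℕ) (h' : ℕ),
        pathP (2 * i) 0 (2 * h) * pathP (2 * q) (2 * h) (2 * h') *
          pathP (2 * j) (2 * h') 0) ∧
    (catalan (i + j + q + 1) : ℤ) =
      (∑ᶠ (h : ℕ) (h' : ℕ),
        pathP (2 * i + 1) 0 (2 * h + 1) * pathP (2 * q) (2 * h + 1) (2 * h' + 1) *
          pathP (2 * j + 1) (2 * h' + 1) 0) := by
  refine ⟨finite_support_pathP_mul_mul _ _ _ _ _ 0, finite_support_pathP_mul_mul _ _ _ _ _ 1,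
    ?_, ?_⟩
  · rw [← pathP_two_mul_zero_zero, show 2 * (i + j + q) = 2 * i + (2 * q + 2 * j) by ring]
    exact pathP_add_add_eq_finsum _ _ _ _ _ 0 (by omega) (by omega) (by omega)
  · rw [← pathP_two_mul_zero_zero,
      show 2 * (i + j + q + 1) = 2 * i + 1 + (2 * q + (2 * j + 1)) by ring]
    exact pathP_add_add_eq_finsum _ _ _ _ _ 1 (by omega) (by omega) (by omega)
end

section
/- Let p ≥ 0 and let a_0, …, a_p be real numbers; set b_n = Σ_{q=0}^p a_q·C(2q, q+n) for n ∈ ℤ (so b_n = 0 for |n| > p and b_{−n} = b_n), and w̃_n = Σ_{q=0}^p a_q·Cat(n+q) for n ≥ 0. Then for every d ≥ 1: det_{0≤i,j≤d−1}( w̃_{i+j} ) = det_{0≤i,j≤d−1}( b_{i−j} − b_{i+j+1} ) and det_{0≤i,j≤d−1}( w̃_{i+j+1} ) = det_{0≤i,j≤d−1}( b_{i−j} − b_{i+j+2} ). -/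
/-- `C(m, k)` with integer argument, taken to be `0` unless `0 ≤ k ≤ m`. -/
noncomputable def zchoose (m : ℕ) (k : ℤ) : ℝ :=
  if 0 ≤ k ∧ k ≤ (m : ℤ) then (m.choose k.toNat : ℝ) else 0

/-- `b_n = Σ_{q=0}^p a_q · C(2q, q+n)`. -/
noncomputable def bseq (p : ℕ) (a : ℕ → ℝ) (n : ℤ) : ℝ :=
  ∑ q ∈ Finset.range (p + 1), a q * zchoose (2 * q) ((q : ℤ) + n)

/-- `w̃_n = Σ_{q=0}^p a_q · Cat(n+q)`. -/
noncomputable def wtil (p : ℕ) (a : ℕ → ℝ) (n : ℕ) : ℝ :=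
  ∑ q ∈ Finset.range (p + 1), a q * (catalan (n + q) : ℝ)

lemma zchoose_of_neg (m : ℕ) {k : ℤ} (hk : k < 0) : zchoose m k = 0 := by
  rw [zchoose, if_neg (by omega)]

lemma zchoose_natCast (m k : ℕ) : zchoose m k = m.choose k := by
  rw [zchoose]
  split_ifs with h
  · simp
  · rw [Nat.choose_eq_zero_of_lt (by omega), Nat.cast_zero]

lemma zchoose_of_lt (m : ℕ) {k : ℤ} (hk : (m : ℤ) < k) : zchoose m k = 0 := by
  rw [zchoose, if_neg (by omega)]

/-- Pascal's rule. -/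
lemma zchoose_succ (m : ℕ) (k : ℤ) :
    zchoose (m + 1) k = zchoose m (k - 1) + zchoose m k := by
  rcases lt_trichotomy k 0 with hk | rfl | hk
  · simp [zchoose_of_neg, hk, show k - 1 < 0 by omega]
  · rw [zchoose_of_neg m (by norm_num : (0 : ℤ) - 1 < 0)]
    rw [show (0 : ℤ) = (0 : ℕ) from rfl, zchoose_natCast, zchoose_natCast]
    simp
  · obtain ⟨n, rfl⟩ : ∃ n : ℕ, k = ((n + 1 : ℕ) : ℤ) := ⟨(k - 1).toNat, by omega⟩
    rw [show ((n + 1 : ℕ) : ℤ) - 1 = (n : ℤ) by push_cast; ring, zchoose_natCast, zchoose_natCast,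
      zchoose_natCast, Nat.choose_succ_succ', Nat.cast_add]

lemma zchoose_symm (m : ℕ) {k l : ℤ} (h : k + l = m) : zchoose m k = zchoose m l := by
  by_cases hk : 0 ≤ k ∧ k ≤ m
  · rw [zchoose, zchoose, if_pos hk, if_pos (by omega),
      Nat.choose_symm_of_eq_add (by omega : m = k.toNat + l.toNat)]
  · rw [zchoose, zchoose, if_neg hk, if_neg (by omega)]

lemma zchoose_two_mul_succ (q : ℕ) (k : ℤ) :
    zchoose (2 * (q + 1)) k =
      zchoose (2 * q) (k - 2) + 2 * zchoose (2 * q) (k - 1) + zchoose (2 * q) k := by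
  rw [show 2 * (q + 1) = 2 * q + 1 + 1 by ring, zchoose_succ, zchoose_succ, zchoose_succ _ k,
    show k - 1 - 1 = k - 2 by ring]
  ring

/-- A Toeplitz-minus-Hankel matrix. For `0 ≤ k, l` and `0 < s` the entry counts the `±1` walks of
length `2q` from `2k` to `2l` that avoid `-s`, by the reflection principle. -/
noncomputable def reflectedWalk (s : ℤ) (q : ℕ) (k l : ℤ) : ℝ :=
  zchoose (2 * q) (q + (k - l)) - zchoose (2 * q) (q + (k + l + s))

lemma reflectedWalk_comm (s : ℤ) (q : ℕ) (k l : ℤ) :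
    reflectedWalk s q k l = reflectedWalk s q l k := by
  rw [reflectedWalk, reflectedWalk, add_comm k l]
  congr 1
  exact zchoose_symm _ (by push_cast; ring)

lemma reflectedWalk_succ (s : ℤ) (q : ℕ) (k l : ℤ) :
    reflectedWalk s (q + 1) k l =
      reflectedWalk s q (k - 1) l + 2 * reflectedWalk s q k l + reflectedWalk s q (k + 1) l := by
  simp only [reflectedWalk, zchoose_two_mul_succ]
  push_cast
  ring_nf

lemma reflectedWalk_reflect (s : ℤ) (q : ℕ) (k l : ℤ) :
    reflectedWalk s q (-s - k) l = -reflectedWalk s q k l := by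
  rw [reflectedWalk, reflectedWalk, neg_sub]
  congr 1 <;> exact zchoose_symm _ (by push_cast; ring)

lemma reflectedWalk_boundary {s : ℤ} (hs : s = 1 ∨ s = 2) (q r : ℕ) (l m : ℤ) :
    reflectedWalk s q (-1) l * reflectedWalk s r 0 m =
      reflectedWalk s q 0 l * reflectedWalk s r (-1) m := by
  rcases hs with rfl | rfl
  · have h (t : ℕ) (n : ℤ) := reflectedWalk_reflect 1 t 0 n
    norm_num at h
    rw [h, h]
    ring
  · have h (t : ℕ) (n : ℤ) : reflectedWalk 2 t (-1) n = 0 := by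
      have := reflectedWalk_reflect 2 t (-1) n
      norm_num at this
      linarith
    rw [h, h]
    ring

lemma reflectedWalk_eq_zero {s : ℤ} (hs : 0 ≤ s) (q : ℕ) {k : ℤ} (hk : (q : ℤ) < k) :
    reflectedWalk s q k 0 = 0 := by
  rw [reflectedWalk, zchoose_of_lt _ (by push_cast; omega),
    zchoose_of_lt _ (by push_cast; omega), sub_zero]

lemma reflectedWalk_self {s : ℤ} (hs : 0 < s) (q : ℕ) : reflectedWalk s q q 0 = 1 := by
  rw [reflectedWalk, zchoose_of_lt (2 * q) (k := q + (q + 0 + s)) (by push_cast; omega),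
    show (q : ℤ) + (q - 0) = ((2 * q : ℕ) : ℤ) by push_cast; ring, zchoose_natCast]
  simp

/-- The operator `u ↦ u (k - 1) + 2 u k + u (k + 1)` is symmetric up to boundary terms. -/
lemma sum_second_difference (u v : ℤ → ℝ) (n : ℕ) :
    ∑ k ∈ Finset.range n, (u (k - 1) + 2 * u k + u (k + 1)) * v k =
      ∑ k ∈ Finset.range n, u k * (v (k - 1) + 2 * v k + v (k + 1)) +
        (u (-1) * v 0 - u 0 * v (-1)) + (u n * v (n - 1) - u (n - 1) * v n) := by
  induction n with
  | zero => simp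
  | succ n ih =>
    rw [Finset.sum_range_succ, Finset.sum_range_succ, ih]
    push_cast
    rw [add_sub_cancel_right]
    ring

lemma sum_reflectedWalk_mul {s : ℤ} (hs : s = 1 ∨ s = 2) {d i : ℕ} (hi : i < d) (q : ℕ) (l : ℤ) :
    ∑ k ∈ Finset.range d, reflectedWalk s i k 0 * reflectedWalk s q k l =
      reflectedWalk s (q + i) 0 l := by
  have hs0 : 0 < s := by omega
  induction i generalizing q with
  | zero =>
    rw [Finset.sum_eq_single_of_mem 0 (Finset.mem_range.2 hi)]
    · have := reflectedWalk_self hs0 0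
      simp_all
    · intro k _ hk
      rw [reflectedWalk_eq_zero hs0.le _ (by omega), zero_mul]
  | succ i ih =>
    have h := sum_second_difference (fun k => reflectedWalk s i k 0)
      (fun k => reflectedWalk s q k l) d
    simp only [← reflectedWalk_succ] at h
    rw [h, ih (by omega), reflectedWalk_boundary hs, reflectedWalk_eq_zero hs0.le i (k := d)
      (by omega), reflectedWalk_eq_zero hs0.le i (k := d - 1) (by omega), add_right_comm q 1 i]
    simp [add_assoc]

lemma det_sum_reflectedWalk {s : ℤ} (hs : s = 1 ∨ s = 2) (p : ℕ) (a : ℕ → ℝ) (d : ℕ) :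
    Matrix.det (Matrix.of fun i k : Fin d =>
        ∑ q ∈ Finset.range (p + 1), a q * reflectedWalk s (i.1 + k.1 + q) 0 0) =
      Matrix.det (Matrix.of fun i k : Fin d =>
        ∑ q ∈ Finset.range (p + 1), a q * reflectedWalk s q i.1 k.1) := by
  have hs0 : 0 < s := by omega
  let U : Matrix (Fin d) (Fin d) ℝ := Matrix.of fun i k => reflectedWalk s i.1 k.1 0
  have hU (i k : Fin d) : U i k = reflectedWalk s i.1 k.1 0 := rfl
  have hdet : U.det = 1 := by
    rw [Matrix.det_of_isLowerTriangular U
      fun i k hik => reflectedWalk_eq_zero hs0.le _ (by simpa using hik)]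
    exact Finset.prod_eq_one fun i _ => reflectedWalk_self hs0 _
  let B : Matrix (Fin d) (Fin d) ℝ := Matrix.of fun i k : Fin d =>
    ∑ q ∈ Finset.range (p + 1), a q * reflectedWalk s q i.1 k.1
  have hB (i k : Fin d) :
      B i k = ∑ q ∈ Finset.range (p + 1), a q * reflectedWalk s q i.1 k.1 := rfl
  have hUB (i k : Fin d) : (U * B) i k =
      ∑ q ∈ Finset.range (p + 1), a q * reflectedWalk s (q + i.1) k.1 0 := by
    simp only [Matrix.mul_apply, hU, hB, Finset.mul_sum]
    rw [Finset.sum_comm]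
    refine Finset.sum_congr rfl fun q _ => ?_
    rw [reflectedWalk_comm, ← sum_reflectedWalk_mul hs i.2, ← Fin.sum_univ_eq_sum_range
      (fun m : ℕ => reflectedWalk s i.1 m 0 * reflectedWalk s q m k.1), Finset.mul_sum]
    exact Finset.sum_congr rfl fun m _ => by ring
  have hprod : (Matrix.of fun i k : Fin d =>
      ∑ q ∈ Finset.range (p + 1), a q * reflectedWalk s (i.1 + k.1 + q) 0 0) =
      U * B * U.transpose := by
    ext i k
    rw [Matrix.of_apply, Matrix.mul_apply]
    simp only [hUB, hU, Matrix.transpose_apply, Finset.sum_mul]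
    rw [Finset.sum_comm]
    refine Finset.sum_congr rfl fun q _ => ?_
    rw [show i.1 + k.1 + q = q + i.1 + k.1 by ring, ← sum_reflectedWalk_mul hs k.2,
      ← Fin.sum_univ_eq_sum_range
      (fun m : ℕ => reflectedWalk s k.1 m 0 * reflectedWalk s (q + i.1) m 0), Finset.mul_sum]
    exact Finset.sum_congr rfl fun m _ => by ring
  rw [hprod, Matrix.det_mul, Matrix.det_mul, Matrix.det_transpose, hdet, one_mul, mul_one]

lemma reflectedWalk_one_eq_catalan (n : ℕ) : reflectedWalk 1 n 0 0 = catalan n := by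
  have h1 := succ_mul_catalan_eq_centralBinom n
  have h2 := Nat.choose_succ_right_eq (2 * n) n
  rw [Nat.centralBinom_eq_two_mul_choose] at h1
  rw [show 2 * n - n = n by omega] at h2
  rw [reflectedWalk, show (n : ℤ) + (0 - 0) = (n : ℕ) by ring,
    show (n : ℤ) + (0 + 0 + 1) = (n + 1 : ℕ) by push_cast; ring, zchoose_natCast, zchoose_natCast]
  rify at h1 h2
  have : (n + 1 : ℝ) ≠ 0 := by positivity
  apply mul_left_cancel₀ this
  linear_combination -h1 - h2

lemma reflectedWalk_two_eq_catalan (n : ℕ) : reflectedWalk 2 n 0 0 = catalan (n + 1) := by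
  have h := reflectedWalk_succ 1 n 0 0
  have hr := reflectedWalk_reflect 1 n 0 0
  norm_num at h hr
  rw [← reflectedWalk_one_eq_catalan, h, hr]
  simp only [reflectedWalk]
  ring_nf

theorem hankel_eq_toeplitz_hankel (p : ℕ) (a : ℕ → ℝ) (d : ℕ) (hd : 1 ≤ d) :
    Matrix.det (Matrix.of fun i k : Fin d => wtil p a (i.1 + k.1)) =
      Matrix.det (Matrix.of fun i k : Fin d =>
        bseq p a ((i.1 : ℤ) - (k.1 : ℤ)) - bseq p a ((i.1 : ℤ) + (k.1 : ℤ) + 1)) ∧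
    Matrix.det (Matrix.of fun i k : Fin d => wtil p a (i.1 + k.1 + 1)) =
      Matrix.det (Matrix.of fun i k : Fin d =>
        bseq p a ((i.1 : ℤ) - (k.1 : ℤ)) - bseq p a ((i.1 : ℤ) + (k.1 : ℤ) + 2)) := by
  have hB (s : ℤ) (i k : ℕ) : bseq p a ((i : ℤ) - k) - bseq p a ((i : ℤ) + k + s) =
      ∑ q ∈ Finset.range (p + 1), a q * reflectedWalk s q i k := by
    simp only [bseq, reflectedWalk, mul_sub, Finset.sum_sub_distrib]
  simp only [hB, ← det_sum_reflectedWalk (Or.inl rfl), ← det_sum_reflectedWalk (Or.inr rfl), wtil,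
    reflectedWalk_one_eq_catalan, reflectedWalk_two_eq_catalan, add_right_comm _ 1, and_self]
end

section
/- Fix an integer p ≥ 1, real numbers a_0, …, a_p with a_p ≠ 0, and R > 0. Set b_n = Σ_{q=0}^p a_q·C(2q, q+n) for n ∈ ℤ, and suppose x_1, …, x_p are nonzero complex numbers such that Σ_{n=−p}^p b_n y^n = a_p·y^{−p}·∏_{i=1}^p (y − x_i²)(y − x_i^{−2}) for all y ≠ 0. For d ≥ 1 define u_d = det_{1≤i,j≤p}( x_i^{d+2j−2} − x_i^{−(d+2j−2)} ). Set w_n = R^n·Σ_{q=0}^p a_q·Cat(n+q), and define the Hankel determinants h_n^{(0)} = det_{0≤i,j≤n} w_{i+j}, h_n^{(1)} = det_{0≤i,j≤n} w_{i+j+1}, with h_{−1}^{(0)} = h_{−1}^{(1)} = 1. Then for every n ≥ 0 for which the denominators below are nonzero: (h_n^{(1)}·h_{n−1}^{(0)})/(h_{n−1}^{(1)}·h_n^{(0)}) = R·u_{2n+1}·u_{2n+4}/(u_{2n+2}·u_{2n+3}), and (h_{n+1}^{(0)}·h_{n−1}^{(1)})/(h_n^{(0)}·h_n^{(1)}) =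 R·u_{2n+2}·u_{2n+5}/(u_{2n+3}·u_{2n+4}). -/
/-- `w_n = Rⁿ · Σ_{q=0}^p a_q · Cat(n+q)`. -/
noncomputable def wseq (p : ℕ) (a : ℕ → ℝ) (R : ℝ) (n : ℕ) : ℝ :=
  R ^ n * ∑ q ∈ Finset.range (p + 1), a q * (catalan (n + q) : ℝ)

/-- Hankel determinant of size `n` built on `w`, with entries `w(i+j+shift)`;
`hank w 0 (n+1)` is `h_n^{(0)}`, `hank w 1 (n+1)` is `h_n^{(1)}`, and
`hank w _ 0 = 1` encodes `h_{-1}^{(0)} = h_{-1}^{(1)} = 1`. -/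
noncomputable def hank (w : ℕ → ℝ) (shift n : ℕ) : ℝ :=
  Matrix.det (Matrix.of fun i k : Fin n => w (i.1 + k.1 + shift))

/-- `u_d = det_{1≤i,j≤p} ( x_i^{d+2j−2} − x_i^{−(d+2j−2)} )`. -/
noncomputable def useq (p : ℕ) (x : Fin p → ℂ) (d : ℕ) : ℂ :=
  Matrix.det (Matrix.of fun i k : Fin p =>
    x i ^ ((d : ℤ) + 2 * (k.1 : ℤ)) - x i ^ (-((d : ℤ) + 2 * (k.1 : ℤ))))

open Polynomial

section Christoffel

variable {K : Type*} [CommRing K]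

theorem det_linearMap_apply_monic {N : ℕ} (φ : Fin N → K[X] →ₗ[K] K) (P : Fin N → K[X])
    (hdeg : ∀ j, (P j).natDegree = j) (hmonic : ∀ j, (P j).Monic) :
    (Matrix.of fun i j => φ i (P j)).det =
      (Matrix.of fun i j : Fin N => φ i (X ^ (j : ℕ))).det := by
  have hmul : (Matrix.of fun i j => φ i (P j)) =
      (Matrix.of fun i j : Fin N => φ i (X ^ (j : ℕ))) *
        Matrix.of fun i j : Fin N => (P j).coeff i := by
    ext i j
    simp only [Matrix.mul_apply, Matrix.of_apply]
    conv_lhs => rw [(P j).as_sum_range_C_mul_X_pow' ((hdeg j).trans_lt j.2)]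
    rw [map_sum, ← Fin.sum_univ_eq_sum_range
      (fun k => φ i (C ((P j).coeff k) * X ^ k)) N]
    refine Finset.sum_congr rfl fun k _ => ?_
    rw [← smul_eq_C_mul, map_smul, smul_eq_mul, mul_comm]
  rw [hmul, Matrix.det_mul, Matrix.det_matrixOfPolynomials P hdeg hmonic, mul_one]

theorem val_finRotate_pow (N k : ℕ) (i : Fin N) :
    ((finRotate N ^ k) i : ℕ) = (i + k) % N := by
  cases N with
  | zero => exact i.elim0
  | succ N =>
    induction k with
    | zero => simp [Nat.mod_eq_of_lt i.2]
    | succ k ih =>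
      rw [pow_succ', Equiv.Perm.mul_apply, finRotate_apply, Fin.val_add, ih, Fin.val_one',
        ← Nat.add_mod, add_assoc]

theorem sign_finRotate_pow (p m : ℕ) :
    Equiv.Perm.sign (finRotate (p + m) ^ m) = ((-1) ^ p) ^ m := by
  rw [map_pow, sign_finRotate]
  cases m with
  | zero => simp
  | succ m =>
    rw [← add_assoc, Nat.add_sub_cancel, pow_add (-1) p m, mul_pow, ← pow_mul (-1) m,
      (Nat.even_mul_succ_self m).neg_one_pow, mul_one]

/-- Christoffel's formula: the Hankel determinant of the functional `f ↦ L (f * ∏ (X - z i))` in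
terms of the monic orthogonal polynomials of `L`, all of whose squared norms equal `1`. -/
theorem vandermonde_mul_det_hankel {p : ℕ} (m : ℕ) (L : K[X] →ₗ[K] K) (P : ℕ → K[X])
    (hdeg : ∀ j, (P j).natDegree = j) (hmonic : ∀ j, (P j).Monic)
    (hlt : ∀ i j, i < j → L (X ^ i * P j) = 0) (hself : ∀ i, L (X ^ i * P i) = 1)
    (z : Fin p → K) :
    (Matrix.vandermonde z).det *
        (Matrix.of fun i j : Fin m => L (X ^ (i + j : ℕ) * ∏ k, (X - C (z k)))).det =
      ((-1) ^ p) ^ m * (Matrix.of fun i k : Fin p => (P (m + k)).eval (z i)).det := by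
  nontriviality K
  set Z : K[X] := ∏ k, (X - C (z k)) with hZ
  have hZmonic : Z.Monic := monic_prod_of_monic _ _ fun k _ => monic_X_sub_C _
  have hZdeg : Z.natDegree = p := by
    rw [hZ, natDegree_prod_of_monic _ _ fun k _ => monic_X_sub_C _]
    simp
  have hZeval : ∀ i, Z.eval (z i) = 0 := fun i => by
    rw [hZ, eval_prod]
    exact Finset.prod_eq_zero (Finset.mem_univ i) (by simp)
  let φ : Fin (p + m) → K[X] →ₗ[K] K :=
    Fin.append (fun i => leval (z i)) (fun i => L ∘ₗ LinearMap.mulLeft K (X ^ (i : ℕ)))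
  let B : Fin (p + m) → K[X] :=
    Fin.append (fun k : Fin p => X ^ (k : ℕ)) (fun j : Fin m => X ^ (j : ℕ) * Z)
  have hB : (Matrix.of fun i j => φ i (B j)).det =
      (Matrix.of fun i j : Fin (p + m) => φ i (X ^ (j : ℕ))).det := by
    refine det_linearMap_apply_monic φ B (fun j => ?_) (fun j => ?_)
    · refine Fin.addCases (fun k => ?_) (fun k => ?_) j
      · simp [B]
      · simp [B, (monic_X_pow (R := K) (k : ℕ)).natDegree_mul hZmonic, hZdeg, add_comm]
    · refine Fin.addCases (fun k => ?_) (fun k => ?_) j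
      · simp [B]
      · simpa [B] using (monic_X_pow _).mul hZmonic
  have hP := det_linearMap_apply_monic φ (fun j => P j) (fun j => hdeg j) (fun j => hmonic j)
  have hBblock : (Matrix.of fun i j => φ i (B j)).submatrix finSumFinEquiv finSumFinEquiv =
      Matrix.fromBlocks (Matrix.vandermonde z) 0
        (Matrix.of fun (i : Fin m) (j : Fin p) => L (X ^ (i : ℕ) * X ^ (j : ℕ)))
        (Matrix.of fun i j : Fin m => L (X ^ (i + j : ℕ) * Z)) := by
    ext (i | i) (j | j) <;>
      simp [φ, B, leval, Matrix.vandermonde_apply, hZeval, pow_add, mul_assoc]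
  set σ := finRotate (p + m) ^ m with hσ
  have hσl : ∀ k : Fin p, (σ (Fin.castAdd m k) : ℕ) = m + k := fun k => by
    rw [hσ, val_finRotate_pow, Nat.mod_eq_of_lt] <;> simp <;> omega
  have hσr : ∀ k : Fin m, (σ (Fin.natAdd p k) : ℕ) = k := fun k => by
    rw [hσ, val_finRotate_pow, Fin.val_natAdd,
      show p + (k : ℕ) + m = k + (p + m) by omega, Nat.add_mod_right, Nat.mod_eq_of_lt (by omega)]
  have hPblock : ((Matrix.of fun i j : Fin (p + m) => φ i (P j)).submatrix id σ).submatrix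
        finSumFinEquiv finSumFinEquiv =
      Matrix.fromBlocks (Matrix.of fun i k : Fin p => (P (m + k)).eval (z i))
        (Matrix.of fun (i : Fin p) (k : Fin m) => (P k).eval (z i)) 0
        (Matrix.of fun i j : Fin m => L (X ^ (i : ℕ) * P j)) := by
    ext (i | i) (j | j) <;> simp [φ, leval, hσl, hσr]
    exact hlt _ _ (by omega)
  have htri : (Matrix.of fun i j : Fin m => L (X ^ (i : ℕ) * P j)).det = 1 := by
    rw [Matrix.det_of_isLowerTriangular]
    · simp [hself]
    · exact fun i j hij => hlt i j hij
  have hBdet := Matrix.det_submatrix_equiv_self finSumFinEquiv (Matrix.of fun i j => φ i (B j))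
  rw [hBblock, Matrix.det_fromBlocks_zero₁₂, hB, ← hP] at hBdet
  have hPdet := Matrix.det_submatrix_equiv_self finSumFinEquiv
    ((Matrix.of fun i j : Fin (p + m) => φ i (P j)).submatrix id σ)
  rw [hPblock, Matrix.det_fromBlocks_zero₂₁, htri, mul_one, Matrix.det_permute', hσ,
    sign_finRotate_pow] at hPdet
  rw [hBdet, hPdet, ← mul_assoc]
  push_cast
  rw [← mul_pow, ← mul_pow]
  simp

end Christoffel

section Catalan

/-- The polynomials `U_{2n}(√X / 2)` and `U_{2n+1}(√X / 2) / √X`, for `U` the Chebyshev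
polynomials of the second kind. -/
noncomputable def catalanOrthoPair : ℕ → ℂ[X] × ℂ[X]
  | 0 => (1, 1)
  | n + 1 =>
    (X * (catalanOrthoPair n).2 - (catalanOrthoPair n).1,
      X * (catalanOrthoPair n).2 - (catalanOrthoPair n).1 - (catalanOrthoPair n).2)

/-- The orthogonal polynomials of the moments `catalan n`. -/
noncomputable def catalanOrtho (n : ℕ) : ℂ[X] := (catalanOrthoPair n).1

/-- The orthogonal polynomials of the moments `catalan (n + 1)`. -/
noncomputable def shiftedCatalanOrtho (n : ℕ) : ℂ[X] := (catalanOrthoPair n).2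

theorem catalanOrtho_succ (n : ℕ) :
    catalanOrtho (n + 1) = X * shiftedCatalanOrtho n - catalanOrtho n := rfl

theorem shiftedCatalanOrtho_succ (n : ℕ) :
    shiftedCatalanOrtho (n + 1) = catalanOrtho (n + 1) - shiftedCatalanOrtho n := rfl

theorem catalanOrtho_monic_natDegree (n : ℕ) :
    ((catalanOrtho n).Monic ∧ (catalanOrtho n).natDegree = n) ∧
      (shiftedCatalanOrtho n).Monic ∧ (shiftedCatalanOrtho n).natDegree = n := by
  induction n with
  | zero => simp [catalanOrtho, shiftedCatalanOrtho, catalanOrthoPair]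
  | succ n ih =>
    obtain ⟨⟨hP, hPd⟩, hQ, hQd⟩ := ih
    have hXQ : (X * shiftedCatalanOrtho n).Monic := monic_X.mul hQ
    have hXQd : (X * shiftedCatalanOrtho n).natDegree = n + 1 := by
      rw [monic_X.natDegree_mul hQ, natDegree_X, hQd, add_comm]
    have hlt : (catalanOrtho n).natDegree < (X * shiftedCatalanOrtho n).natDegree := by omega
    have hP' : (catalanOrtho (n + 1)).Monic := hXQ.sub_of_left (degree_lt_degree hlt)
    have hPd' : (catalanOrtho (n + 1)).natDegree = n + 1 := by
      rw [catalanOrtho_succ, natDegree_sub_eq_left_of_natDegree_lt hlt, hXQd]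
    have hlt' : (shiftedCatalanOrtho n).natDegree < (catalanOrtho (n + 1)).natDegree := by omega
    refine ⟨⟨hP', hPd'⟩, hP'.sub_of_left (degree_lt_degree hlt'), ?_⟩
    rw [shiftedCatalanOrtho_succ, natDegree_sub_eq_left_of_natDegree_lt hlt', hPd']

/-- The linear functional on polynomials with moments `catalan n`. -/
noncomputable def catalanFunctional : ℂ[X] →ₗ[ℂ] ℂ :=
  lsum fun n => (catalan n : ℂ) • LinearMap.id

theorem catalanFunctional_X_pow (n : ℕ) : catalanFunctional (X ^ n) = catalan n := by
  simp [catalanFunctional, lsum_apply, X_pow_eq_monomial]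

theorem catalan_eq_choose_sub (n : ℕ) :
    (catalan n : ℂ) = (2 * n).choose n - (2 * n).choose (n + 1) := by
  have h1 : ((n + 1 : ℕ) : ℂ) * catalan n = (2 * n).choose n := by
    rw [← Nat.centralBinom_eq_two_mul_choose]
    exact_mod_cast succ_mul_catalan_eq_centralBinom n
  have h2 := Nat.choose_succ_right_eq (2 * n) n
  rw [show 2 * n - n = n by omega] at h2
  have h3 : ((2 * n).choose (n + 1) : ℂ) * (n + 1) = (2 * n).choose n * n := by
    exact_mod_cast h2
  have h0 : (n + 1 : ℂ) ≠ 0 := by exact_mod_cast n.succ_ne_zero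
  push_cast at h1
  apply mul_left_cancel₀ h0
  linear_combination h1 + h3

theorem catalan_succ_eq_choose_sub (n : ℕ) :
    (catalan (n + 1) : ℂ) = (2 * n + 1).choose (n + 1) - (2 * n + 1).choose (n + 2) := by
  rw [catalan_eq_choose_sub, show 2 * (n + 1) = 2 * n + 1 + 1 by ring, Nat.choose_succ_succ',
    Nat.choose_succ_succ' (2 * n + 1) (n + 1), ← Nat.choose_symm_half n]
  push_cast
  ring

theorem catalanFunctional_mul_ortho (j : ℕ) :
    (∀ i, catalanFunctional (X ^ i * catalanOrtho j) =
        (2 * i).choose (i + j) - (2 * i).choose (i + j + 1)) ∧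
      ∀ i, catalanFunctional (X ^ (i + 1) * shiftedCatalanOrtho j) =
        (2 * i + 1).choose (i + j + 1) - (2 * i + 1).choose (i + j + 2) := by
  induction j with
  | zero =>
    refine ⟨fun i => ?_, fun i => ?_⟩
    · simp [catalanOrtho, catalanOrthoPair, catalanFunctional_X_pow, catalan_eq_choose_sub]
    · simp [shiftedCatalanOrtho, catalanOrthoPair, catalanFunctional_X_pow,
        catalan_succ_eq_choose_sub]
  | succ j ih =>
    obtain ⟨hP, hQ⟩ := ih
    have hP' : ∀ i, catalanFunctional (X ^ i * catalanOrtho (j + 1)) =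
        (2 * i).choose (i + (j + 1)) - (2 * i).choose (i + (j + 1) + 1) := fun i => by
      rw [catalanOrtho_succ, mul_sub, map_sub, ← mul_assoc, ← pow_succ, hP, hQ,
        Nat.choose_succ_succ', Nat.choose_succ_succ' (2 * i) (i + j + 1)]
      push_cast
      ring_nf
    refine ⟨hP', fun i => ?_⟩
    rw [shiftedCatalanOrtho_succ, mul_sub, map_sub, hQ, hP',
      show 2 * (i + 1) = 2 * i + 1 + 1 by ring,
      show i + 1 + (j + 1) = i + j + 1 + 1 by ring,
      Nat.choose_succ_succ', Nat.choose_succ_succ' (2 * i + 1) (i + j + 1 + 1)]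
    push_cast
    ring_nf

theorem eval_catalanOrtho {x : ℂ} (hx : x ≠ 0) (n : ℕ) :
    (x ^ (1 : ℤ) - x ^ (-1 : ℤ)) * (catalanOrtho n).eval (x ^ (2 : ℤ) + 2 + x ^ (-2 : ℤ)) =
        x ^ (2 * (n : ℤ) + 1) - x ^ (-(2 * (n : ℤ) + 1)) ∧
      (x ^ (2 : ℤ) - x ^ (-2 : ℤ)) *
          (shiftedCatalanOrtho n).eval (x ^ (2 : ℤ) + 2 + x ^ (-2 : ℤ)) =
        x ^ (2 * (n : ℤ) + 2) - x ^ (-(2 * (n : ℤ) + 2)) := by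
  induction n with
  | zero => simp [catalanOrtho, shiftedCatalanOrtho, catalanOrthoPair]
  | succ n ih =>
    obtain ⟨hP, hQ⟩ := ih
    have hP' : (x ^ (1 : ℤ) - x ^ (-1 : ℤ)) *
          (catalanOrtho (n + 1)).eval (x ^ (2 : ℤ) + 2 + x ^ (-2 : ℤ)) =
        x ^ (2 * ((n + 1 : ℕ) : ℤ) + 1) - x ^ (-(2 * ((n + 1 : ℕ) : ℤ) + 1)) := by
      have : (x ^ (1 : ℤ) - x ^ (-1 : ℤ)) *
            (catalanOrtho (n + 1)).eval (x ^ (2 : ℤ) + 2 + x ^ (-2 : ℤ)) =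
          (x + x⁻¹) * (x ^ (2 * (n : ℤ) + 2) - x ^ (-(2 * (n : ℤ) + 2))) -
            (x ^ (2 * (n : ℤ) + 1) - x ^ (-(2 * (n : ℤ) + 1))) := by
        rw [← hP, ← hQ, catalanOrtho_succ, eval_sub, eval_mul, eval_X]
        simp only [zpow_neg, zpow_ofNat]
        field_simp
        ring
      rw [this]
      push_cast
      simp only [zpow_neg, zpow_add₀ hx, mul_add, zpow_ofNat, mul_one]
      field_simp
      ring
    refine ⟨hP', ?_⟩
    have : (x ^ (2 : ℤ) - x ^ (-2 : ℤ)) *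
          (shiftedCatalanOrtho (n + 1)).eval (x ^ (2 : ℤ) + 2 + x ^ (-2 : ℤ)) =
        (x + x⁻¹) * (x ^ (2 * ((n + 1 : ℕ) : ℤ) + 1) - x ^ (-(2 * ((n + 1 : ℕ) : ℤ) + 1))) -
          (x ^ (2 * (n : ℤ) + 2) - x ^ (-(2 * (n : ℤ) + 2))) := by
      rw [← hP', ← hQ, shiftedCatalanOrtho_succ, eval_sub]
      simp only [zpow_neg, zpow_ofNat]
      field_simp
      ring
    rw [this]
    push_cast
    simp only [zpow_neg, zpow_add₀ hx, mul_add, zpow_ofNat, mul_one]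
    field_simp
    ring

end Catalan

theorem sum_zchoose_mul_zpow {p q : ℕ} (hq : q ≤ p) {y : ℂ} (hy : y ≠ 0) :
    ∑ n ∈ Finset.Icc (-(p : ℤ)) p, (zchoose (2 * q) (q + n) : ℂ) * y ^ n =
      (y + 2 + y⁻¹) ^ q := by
  have hbinom : (y + 2 + y⁻¹) ^ q =
      ∑ k ∈ Finset.range (2 * q + 1), ((2 * q).choose k : ℂ) * y ^ ((k : ℤ) - q) := by
    have : y + 2 + y⁻¹ = (y + 1) ^ 2 * y⁻¹ := by field_simp; ring
    rw [this, mul_pow, ← pow_mul, add_pow, Finset.sum_mul]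
    refine Finset.sum_congr rfl fun k _ => ?_
    rw [zpow_sub₀ hy, zpow_natCast, zpow_natCast, one_pow, inv_pow]
    ring
  rw [hbinom]
  symm
  refine Finset.sum_of_injOn (fun k : ℕ => (k : ℤ) - q) (fun k _ l _ h => ?_) (fun k hk => ?_)
    (fun n _ hn => ?_) (fun k hk => ?_)
  · simpa using h
  · simp only [Finset.coe_range, Set.mem_Iio] at hk
    simp only [Finset.coe_Icc, Set.mem_Icc]
    omega
  · rw [zchoose, if_neg, Complex.ofReal_zero, zero_mul]
    rintro ⟨h0, h1⟩
    refine hn ⟨(q + n).toNat, ?_, ?_⟩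
    · simp only [Finset.coe_range, Set.mem_Iio]
      omega
    · simp only
      omega
  · rw [Finset.mem_range] at hk
    rw [zchoose, if_pos (by omega), add_sub_cancel, Int.toNat_natCast, Complex.ofReal_natCast]

theorem sum_bseq_mul_zpow (p : ℕ) (a : ℕ → ℝ) {y : ℂ} (hy : y ≠ 0) :
    ∑ n ∈ Finset.Icc (-(p : ℤ)) p, (bseq p a n : ℂ) * y ^ n =
      ∑ q ∈ Finset.range (p + 1), (a q : ℂ) * (y + 2 + y⁻¹) ^ q := by
  simp only [bseq, Complex.ofReal_sum, Complex.ofReal_mul, Finset.sum_mul]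
  rw [Finset.sum_comm]
  refine Finset.sum_congr rfl fun q hq => ?_
  rw [← sum_zchoose_mul_zpow (Nat.lt_succ_iff.mp (Finset.mem_range.mp hq)) hy, Finset.mul_sum]
  exact Finset.sum_congr rfl fun n _ => mul_assoc _ _ _

theorem exists_ne_zero_add_two_add_inv_eq (z : ℂ) : ∃ y : ℂ, y ≠ 0 ∧ y + 2 + y⁻¹ = z := by
  obtain ⟨s, hs⟩ := IsAlgClosed.exists_eq_mul_self (discrim (1 : ℂ) (2 - z) 1)
  obtain ⟨y, hy⟩ := exists_quadratic_eq_zero one_ne_zero ⟨s, hs⟩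
  have hy0 : y ≠ 0 := by
    rintro rfl
    simp at hy
  refine ⟨y, hy0, ?_⟩
  field_simp
  linear_combination hy

theorem sum_C_mul_X_pow_eq_prod {p : ℕ} {a : ℕ → ℝ} {x : Fin p → ℂ} (hx : ∀ i, x i ≠ 0)
    (hchar : ∀ y : ℂ, y ≠ 0 →
      (∑ n ∈ Finset.Icc (-(p : ℤ)) (p : ℤ), (bseq p a n : ℂ) * y ^ n) =
        (a p : ℂ) * y ^ (-(p : ℤ)) *
          ∏ i : Fin p, ((y - x i ^ (2 : ℤ)) * (y - x i ^ (-2 : ℤ)))) :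
    ∑ q ∈ Finset.range (p + 1), C (a q : ℂ) * X ^ q =
      C (a p : ℂ) * ∏ i, (X - C (x i ^ (2 : ℤ) + 2 + x i ^ (-2 : ℤ))) := by
  refine Polynomial.funext fun z => ?_
  obtain ⟨y, hy, rfl⟩ := exists_ne_zero_add_two_add_inv_eq z
  have h := hchar y hy
  rw [sum_bseq_mul_zpow p a hy] at h
  simp only [eval_finsetSum, eval_mul, eval_C, eval_pow, eval_X, eval_prod, eval_sub]
  have hpow : y ^ (-(p : ℤ)) = ∏ _i : Fin p, y⁻¹ := by simp
  rw [h, mul_assoc, hpow, ← Finset.prod_mul_distrib]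
  congr 1
  refine Finset.prod_congr rfl fun i _ => ?_
  have := hx i
  simp only [zpow_neg, zpow_ofNat]
  field_simp
  ring

theorem useq_eq_prod_mul_det {p d m s : ℕ} {x z : Fin p → ℂ} (c : Fin p → ℂ) (P : ℕ → ℂ[X])
    (h : ∀ i n, c i * (P n).eval (z i) =
      x i ^ (2 * (n : ℤ) + s) - x i ^ (-(2 * (n : ℤ) + s))) (hd : d = 2 * m + s) :
    useq p x d = (∏ i, c i) * (Matrix.of fun i k : Fin p => (P (m + k)).eval (z i)).det := by
  rw [← Matrix.det_mul_column, useq]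
  congr 1
  ext i k
  simp only [Matrix.of_apply]
  rw [h, hd]
  push_cast
  ring_nf

theorem ofReal_wseq (p : ℕ) (a : ℕ → ℝ) (R : ℝ) (n : ℕ) :
    (wseq p a R n : ℂ) =
      R ^ n * catalanFunctional (X ^ n * ∑ q ∈ Finset.range (p + 1), C (a q : ℂ) * X ^ q) := by
  rw [wseq, Complex.ofReal_mul, Complex.ofReal_pow, Complex.ofReal_sum,
    Finset.mul_sum (a := (X ^ n : ℂ[X])), map_sum]
  congr 1
  refine Finset.sum_congr rfl fun q _ => ?_
  rw [mul_left_comm, ← pow_add, ← smul_eq_C_mul, map_smul, catalanFunctional_X_pow]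
  simp

theorem ofReal_hank {w : ℕ → ℝ} {r c : ℂ} {s : ℕ} (f : ℕ → ℂ)
    (hw : ∀ n, (w (n + s) : ℂ) = r ^ (n + s) * (c * f n)) (m : ℕ) :
    (hank w s m : ℂ) = (c * r ^ s) ^ m * (∏ i : Fin m, r ^ (i : ℕ)) ^ 2 *
      (Matrix.of fun i j : Fin m => f (i + j)).det := by
  have hof : (hank w s m : ℂ) = (Matrix.of fun i j : Fin m => (w (i + j + s) : ℂ)).det :=
    Complex.ofRealHom.map_det _
  have hconst : (c * r ^ s) ^ m = ∏ _i : Fin m, c * r ^ s := by simp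
  rw [hof, sq, ← mul_assoc, hconst, ← Finset.prod_mul_distrib, mul_assoc,
    ← Matrix.det_mul_row, ← Matrix.det_mul_column]
  congr 1
  ext i j
  simp only [Matrix.of_apply, hw]
  ring

theorem useq_mul_hank {p : ℕ} {a : ℕ → ℝ} (R : ℝ) {x : Fin p → ℂ} (hx : ∀ i, x i ≠ 0)
    (hchar : ∀ y : ℂ, y ≠ 0 →
      (∑ n ∈ Finset.Icc (-(p : ℤ)) (p : ℤ), (bseq p a n : ℂ) * y ^ n) =
        (a p : ℂ) * y ^ (-(p : ℤ)) *
          ∏ i : Fin p, ((y - x i ^ (2 : ℤ)) * (y - x i ^ (-2 : ℤ)))) (m : ℕ) :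
    useq p x 1 * (hank (wseq p a R) 0 m : ℂ) =
        ((-1) ^ p * a p) ^ m * (∏ i : Fin m, (R : ℂ) ^ (i : ℕ)) ^ 2 * useq p x (2 * m + 1) ∧
      useq p x 2 * (hank (wseq p a R) 1 m : ℂ) =
        ((-1) ^ p * a p) ^ m * (∏ i : Fin m, (R : ℂ) ^ (i : ℕ)) ^ 2 * R ^ m *
          useq p x (2 * m + 2) := by
  set z : Fin p → ℂ := fun i => x i ^ (2 : ℤ) + 2 + x i ^ (-2 : ℤ)
  have hA := sum_C_mul_X_pow_eq_prod hx hchar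
  have hdeg := fun n => catalanOrtho_monic_natDegree n
  constructor
  · have hu := fun k => useq_eq_prod_mul_det (d := 2 * k + 1) (m := k) (s := 1) (x := x) (z := z)
      (fun i => x i ^ (1 : ℤ) - x i ^ (-1 : ℤ)) catalanOrtho
      (fun i n => by exact_mod_cast (eval_catalanOrtho (hx i) n).1) rfl
    have hV := Matrix.det_eval_matrixOfPolynomials_eq_det_vandermonde z
      (fun k => catalanOrtho k) (fun k => (hdeg k).1.2) (fun k => (hdeg k).1.1)
    have hC := vandermonde_mul_det_hankel m catalanFunctional catalanOrtho
      (fun n => (hdeg n).1.2) (fun n => (hdeg n).1.1)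
      (fun i j hij => by
        rw [(catalanFunctional_mul_ortho j).1, Nat.choose_eq_zero_of_lt (by omega),
          Nat.choose_eq_zero_of_lt (by omega), sub_self])
      (fun i => by
        rw [(catalanFunctional_mul_ortho i).1, Nat.choose_eq_zero_of_lt (k := i + i + 1) (by omega),
          ← two_mul, Nat.choose_self]
        simp) z
    have hH := ofReal_hank (w := wseq p a R) (r := R) (c := a p) (s := 0)
      (fun n => catalanFunctional (X ^ n * ∏ k, (X - C (z k))))
      (fun n => by
        rw [ofReal_wseq, hA, mul_left_comm, ← smul_eq_C_mul, map_smul, smul_eq_mul]; rfl) m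
    have hu0 := hu 0
    simp only [mul_zero, zero_add, ← hV] at hu0
    rw [hH, hu m, hu0, mul_pow _ (a p : ℂ)]
    linear_combination (∏ i, (x i ^ (1 : ℤ) - x i ^ (-1 : ℤ))) * (a p : ℂ) ^ m *
      (∏ i : Fin m, (R : ℂ) ^ (i : ℕ)) ^ 2 * hC
  · have hu := fun k => useq_eq_prod_mul_det (d := 2 * k + 2) (m := k) (s := 2) (x := x) (z := z)
      (fun i => x i ^ (2 : ℤ) - x i ^ (-2 : ℤ)) shiftedCatalanOrtho
      (fun i n => by exact_mod_cast (eval_catalanOrtho (hx i) n).2) rfl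
    have hV := Matrix.det_eval_matrixOfPolynomials_eq_det_vandermonde z
      (fun k => shiftedCatalanOrtho k) (fun k => (hdeg k).2.2) (fun k => (hdeg k).2.1)
    have happ : ∀ i f, (catalanFunctional ∘ₗ LinearMap.mulLeft ℂ X) (X ^ i * f) =
        catalanFunctional (X ^ (i + 1) * f) := fun i f => by
      rw [LinearMap.comp_apply, LinearMap.mulLeft_apply, pow_succ', mul_assoc]
    have hC := vandermonde_mul_det_hankel m (catalanFunctional ∘ₗ LinearMap.mulLeft ℂ X)
      shiftedCatalanOrtho (fun n => (hdeg n).2.2) (fun n => (hdeg n).2.1)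
      (fun i j hij => by
        rw [happ, (catalanFunctional_mul_ortho j).2, Nat.choose_eq_zero_of_lt (by omega),
          Nat.choose_eq_zero_of_lt (by omega), sub_self])
      (fun i => by
        rw [happ, (catalanFunctional_mul_ortho i).2,
          Nat.choose_eq_zero_of_lt (k := i + i + 2) (by omega), ← two_mul, Nat.choose_self]
        simp) z
    simp only [happ] at hC
    have hH := ofReal_hank (w := wseq p a R) (r := R) (c := a p) (s := 1)
      (fun n => catalanFunctional (X ^ (n + 1) * ∏ k, (X - C (z k))))
      (fun n => by
        rw [ofReal_wseq, hA, mul_left_comm, ← smul_eq_C_mul, map_smul, smul_eq_mul]) m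
    have hu0 := hu 0
    simp only [mul_zero, zero_add, ← hV] at hu0
    rw [hH, hu m, hu0, mul_pow _ (a p : ℂ)]
    linear_combination (∏ i, (x i ^ (2 : ℤ) - x i ^ (-2 : ℤ))) * (a p : ℂ) ^ m * (R : ℂ) ^ m *
      (∏ i : Fin m, (R : ℂ) ^ (i : ℕ)) ^ 2 * hC

theorem hankel_ratio_eq_schur_ratio (p : ℕ) (hp : 1 ≤ p) (a : ℕ → ℝ) (hap : a p ≠ 0)
    (R : ℝ) (hR : 0 < R) (x : Fin p → ℂ) (hx : ∀ i, x i ≠ 0)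
    (hchar : ∀ y : ℂ, y ≠ 0 →
      (∑ n ∈ Finset.Icc (-(p : ℤ)) (p : ℤ), (bseq p a n : ℂ) * y ^ n) =
        (a p : ℂ) * y ^ (-(p : ℤ)) * ∏ i : Fin p, ((y - x i ^ (2 : ℤ)) * (y - x i ^ (-2 : ℤ))))
    (n : ℕ)
    (h1 : hank (wseq p a R) 1 n ≠ 0)
    (h2 : hank (wseq p a R) 0 (n + 1) ≠ 0)
    (h3 : hank (wseq p a R) 1 (n + 1) ≠ 0)
    (h4 : useq p x (2 * n + 2) ≠ 0)
    (h5 : useq p x (2 * n + 3) ≠ 0)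
    (h6 : useq p x (2 * n + 4) ≠ 0) :
    (((hank (wseq p a R) 1 (n + 1) * hank (wseq p a R) 0 n) /
        (hank (wseq p a R) 1 n * hank (wseq p a R) 0 (n + 1)) : ℝ) : ℂ) =
      (R : ℂ) * useq p x (2 * n + 1) * useq p x (2 * n + 4) /
        (useq p x (2 * n + 2) * useq p x (2 * n + 3)) ∧
    (((hank (wseq p a R) 0 (n + 2) * hank (wseq p a R) 1 n) /
        (hank (wseq p a R) 0 (n + 1) * hank (wseq p a R) 1 (n + 1)) : ℝ) : ℂ) =
      (R : ℂ) * useq p x (2 * n + 2) * useq p x (2 * n + 5) /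
        (useq p x (2 * n + 3) * useq p x (2 * n + 4)) := by
  have hR' : (R : ℂ) ≠ 0 := Complex.ofReal_ne_zero.mpr hR.ne'
  have hk : (-1 : ℂ) ^ p * a p ≠ 0 :=
    mul_ne_zero (pow_ne_zero _ (by norm_num)) (Complex.ofReal_ne_zero.mpr hap)
  have hr : ∀ m : ℕ, ∏ i : Fin m, (R : ℂ) ^ (i : ℕ) ≠ 0 := fun m =>
    Finset.prod_ne_zero_iff.mpr fun i _ => pow_ne_zero _ hR'
  have hr' : ∀ m : ℕ, ∏ i : Fin (m + 1), (R : ℂ) ^ (i : ℕ) =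
      (∏ i : Fin m, (R : ℂ) ^ (i : ℕ)) * R ^ m := fun m => by
    simp [Fin.prod_univ_castSucc]
  have hH := useq_mul_hank R hx hchar
  have hu1 : useq p x 1 ≠ 0 :=
    left_ne_zero_of_mul ((hH (n + 1)).1.trans_ne
      (mul_ne_zero (mul_ne_zero (pow_ne_zero _ hk) (pow_ne_zero _ (hr _))) h5))
  have hu2 : useq p x 2 ≠ 0 :=
    left_ne_zero_of_mul ((hH n).2.trans_ne (mul_ne_zero (mul_ne_zero
      (mul_ne_zero (pow_ne_zero _ hk) (pow_ne_zero _ (hr _))) (pow_ne_zero _ hR')) h4))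
  have hH0 := fun m => eq_div_of_mul_eq hu1 ((mul_comm _ _).trans (hH m).1)
  have hH1 := fun m => eq_div_of_mul_eq hu2 ((mul_comm _ _).trans (hH m).2)
  have hrn := hr n
  push_cast
  simp only [hH0, hH1, hr', show 2 * (n + 1) + 1 = 2 * n + 3 by ring,
    show 2 * (n + 1) + 2 = 2 * n + 4 by ring, show 2 * (n + 2) + 1 = 2 * n + 5 by ring]
  generalize (-1 : ℂ) ^ p * a p = κ at *
  constructor
  · field_simp
    ring
  · field_simp
    ring
end

section
/- For all integers m, n ≥ 1 with m + n even, Σ_{ℓ} ℓ·C(m, (m−ℓ)/2)·C(n, (n+ℓ)/2) = (2/(m+n)) · ( m! / (⌊m/2⌋!·⌊(m−1)/2⌋!) ) · ( n! / (⌊n/2⌋!·⌊(n−1)/2⌋!) ), where the sum runs over integers ℓ with 0 ≤ ℓ ≤ min(m, n) and ℓ ≡ m (mod 2). -/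
theorem Nat.cast_succ_mul_choose_add_succ {a k e : ℕ} (h : k ≤ a) :
    ((a + k + e + 1 : ℕ) : ℚ) * ((2 * a + e).choose (a + k + e + 1) : ℚ) =
      ((a : ℚ) - k) * ((2 * a + e).choose (a + k + e) : ℚ) := by
  have h₁ := Nat.choose_succ_right_eq (2 * a + e) (a + k + e)
  rw [show 2 * a + e - (a + k + e) = a - k by omega] at h₁
  rw [← Nat.cast_sub h, mul_comm, mul_comm ((a - k : ℕ) : ℚ)]
  exact_mod_cast h₁

/-- Telescoped form of the sum over `l ≡ e [MOD 2]`, `l < 2 * K + e`. -/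
theorem sum_mul_choose_mul_choose_telescope {a b e : ℕ} (he : e ≤ 1) {K : ℕ}
    (hKa : K ≤ a + 1) (hKb : K ≤ b + 1) :
    (∑ l ∈ Finset.range (2 * K + e),
        if l % 2 = (2 * a + e) % 2 then
          (l : ℚ) * ((2 * a + e).choose ((2 * a + e - l) / 2) : ℚ) *
            ((2 * b + e).choose ((2 * b + e + l) / 2) : ℚ)
        else 0) * ((a : ℚ) + b + e) =
      ((a + e : ℕ) * ((2 * a + e).choose (a + e) : ℚ)) *
          ((b + e : ℕ) * ((2 * b + e).choose (b + e) : ℚ)) -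
        ((a + K + e : ℕ) * ((2 * a + e).choose (a + K + e) : ℚ)) *
          ((b + K + e : ℕ) * ((2 * b + e).choose (b + K + e) : ℚ)) := by
  induction K with
  | zero =>
    obtain rfl | rfl : e = 0 ∨ e = 1 := by omega
    · simp
    · simp
  | succ k ih =>
    specialize ih (by omega) (by omega)
    have ha := Nat.cast_succ_mul_choose_add_succ (e := e) (show k ≤ a by omega)
    have hb := Nat.cast_succ_mul_choose_add_succ (e := e) (show k ≤ b by omega)
    rw [show 2 * (k + 1) + e = 2 * k + e + 1 + 1 by ring, Finset.sum_range_succ,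
      Finset.sum_range_succ, if_pos (by omega), if_neg (by omega),
      show (2 * a + e - (2 * k + e)) / 2 = a - k by omega,
      show (2 * b + e + (2 * k + e)) / 2 = b + k + e by omega,
      Nat.choose_symm_of_eq_add (show 2 * a + e = (a - k) + (a + k + e) by omega),
      show a + (k + 1) + e = a + k + e + 1 by ring,
      show b + (k + 1) + e = b + k + e + 1 by ring, ha, hb, add_zero, add_mul, ih]
    push_cast
    ring

theorem Nat.cast_mul_choose_middle {a e : ℕ} (he : e ≤ 1) (h : 1 ≤ 2 * a + e) :
    ((a + e : ℕ) : ℚ) * ((2 * a + e).choose (a + e) : ℚ) =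
      (Nat.factorial (2 * a + e) : ℚ) /
        ((Nat.factorial ((2 * a + e) / 2) : ℚ) *
          (Nat.factorial ((2 * a + e - 1) / 2) : ℚ)) := by
  obtain ⟨c, hc⟩ : ∃ c, a + e = c + 1 := ⟨a + e - 1, by omega⟩
  rw [show (2 * a + e) / 2 = a by omega, show (2 * a + e - 1) / 2 = c by omega,
    Nat.cast_choose ℚ (show a + e ≤ 2 * a + e by omega),
    show 2 * a + e - (a + e) = a by omega, hc, Nat.factorial_succ c]
  have h₁ : (Nat.factorial a : ℚ) ≠ 0 := by positivity
  have h₂ : (Nat.factorial c : ℚ) ≠ 0 := by positivity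
  push_cast
  field_simp

theorem annular_map_identity (m n : ℕ) (hm : 1 ≤ m) (hn : 1 ≤ n) (hmn : Even (m + n)) :
    (∑ l ∈ Finset.range (min m n + 1),
        if l % 2 = m % 2 then
          (l : ℚ) * (m.choose ((m - l) / 2) : ℚ) * (n.choose ((n + l) / 2) : ℚ)
        else 0) =
      2 / ((m : ℚ) + (n : ℚ)) *
        ((Nat.factorial m : ℚ) /
          ((Nat.factorial (m / 2) : ℚ) * (Nat.factorial ((m - 1) / 2) : ℚ))) *
        ((Nat.factorial n : ℚ) /
          ((Nat.factorial (n / 2) : ℚ) * (Nat.factorial ((n - 1) / 2) : ℚ))) := by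
  obtain ⟨a, b, e, he, rfl, rfl⟩ :
      ∃ a b e, e ≤ 1 ∧ m = 2 * a + e ∧ n = 2 * b + e := by
    rw [Nat.even_iff] at hmn
    exact ⟨m / 2, n / 2, m % 2, by omega, by omega, by omega⟩
  have key := sum_mul_choose_mul_choose_telescope he
    (show min a b + 1 ≤ a + 1 by omega) (show min a b + 1 ≤ b + 1 by omega)
  have hzero : ((2 * a + e).choose (a + (min a b + 1) + e) : ℚ) *
      ((2 * b + e).choose (b + (min a b + 1) + e) : ℚ) = 0 := by
    rcases le_total a b with h | h
    · rw [Nat.choose_eq_zero_of_lt (show 2 * a + e < a + (min a b + 1) + e by omega)]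
      simp
    · rw [Nat.choose_eq_zero_of_lt (show 2 * b + e < b + (min a b + 1) + e by omega)]
      simp
  rw [mul_mul_mul_comm ((a + (min a b + 1) + e : ℕ) : ℚ), hzero, mul_zero, sub_zero,
    Nat.cast_mul_choose_middle he hm, Nat.cast_mul_choose_middle he hn,
    show 2 * (min a b + 1) + e = min (2 * a + e) (2 * b + e) + 1 + 1 by omega,
    Finset.sum_range_succ, if_neg (by omega), add_zero] at key
  have hpos : (a : ℚ) + b + e ≠ 0 := by
    have : a + b + e ≠ 0 := by omega
    exact_mod_cast this
  rw [mul_assoc, ← key]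
  push_cast
  rw [show (2 * a + e + (2 * b + e) : ℚ) = 2 * (a + b + e) by ring]
  field_simp
end

section
/- For all integers d ≥ 0 and m, n > d with m + n even, Σ_{ℓ} ℓ·C(m, (m−ℓ)/2)·C(n, (n+ℓ)/2) = (2/(m+n)) · ( m! / (⌊(m+d)/2⌋!·⌊(m−1−d)/2⌋!) ) · ( n! / (⌊(n+d)/2⌋!·⌊(n−1−d)/2⌋!) ), where the sum runs over integers ℓ with d < ℓ ≤ min(m, n) and ℓ ≡ m (mod 2). -/
/-- A summand equals the closed form at `d` minus a remainder, which is the closed form at `d + 1`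
when `a` and `b` are positive and vanishes when `a = 0` or `b = 0`. -/
theorem mul_choose_mul_choose_eq_sub (d a b : ℕ) :
    ((d + 1 : ℕ) : ℚ) * ((d + 1 + 2 * a).choose a : ℚ) * ((d + 1 + 2 * b).choose (d + 1 + b) : ℚ) =
      2 / (((d + 1 + 2 * a : ℕ) : ℚ) + ((d + 1 + 2 * b : ℕ) : ℚ)) *
          ((Nat.factorial (d + 1 + 2 * a) : ℚ) / (Nat.factorial (d + a) * Nat.factorial a)) *
          ((Nat.factorial (d + 1 + 2 * b) : ℚ) / (Nat.factorial (d + b) * Nat.factorial b)) -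
        2 / (((d + 1 + 2 * a : ℕ) : ℚ) + ((d + 1 + 2 * b : ℕ) : ℚ)) *
          (a * (Nat.factorial (d + 1 + 2 * a) : ℚ) /
            (Nat.factorial (d + 1 + a) * Nat.factorial a)) *
          (b * (Nat.factorial (d + 1 + 2 * b) : ℚ) /
            (Nat.factorial (d + 1 + b) * Nat.factorial b)) := by
  rw [Nat.cast_choose ℚ (by omega : a ≤ d + 1 + 2 * a),
    Nat.cast_choose ℚ (by omega : d + 1 + b ≤ d + 1 + 2 * b),
    show d + 1 + 2 * a - a = d + a + 1 by omega, show d + 1 + 2 * b - (d + 1 + b) = b by omega,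
    show d + 1 + a = d + a + 1 by omega, show d + 1 + b = d + b + 1 by omega,
    Nat.factorial_succ (d + a), Nat.factorial_succ (d + b)]
  generalize Nat.factorial (d + 1 + 2 * a) = M
  generalize Nat.factorial (d + 1 + 2 * b) = N
  have ha : (Nat.factorial a : ℚ) ≠ 0 := by positivity
  have hb : (Nat.factorial b : ℚ) ≠ 0 := by positivity
  have hda : (Nat.factorial (d + a) : ℚ) ≠ 0 := by positivity
  have hdb : (Nat.factorial (d + b) : ℚ) ≠ 0 := by positivity
  have h1 : (d + a + 1 : ℚ) ≠ 0 := by positivity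
  have h2 : (d + b + 1 : ℚ) ≠ 0 := by positivity
  have h3 : (d + 1 + 2 * a + (d + 1 + 2 * b) : ℚ) ≠ 0 := by positivity
  push_cast
  field_simp
  ring


theorem irreducible_annular_map_identity (d m n : ℕ) (hm : d < m) (hn : d < n)
    (hmn : Even (m + n)) :
    (∑ l ∈ Finset.Icc (d + 1) (min m n),
        if l % 2 = m % 2 then
          (l : ℚ) * (m.choose ((m - l) / 2) : ℚ) * (n.choose ((n + l) / 2) : ℚ)
        else 0) =
      2 / ((m : ℚ) + (n : ℚ)) *
        ((Nat.factorial m : ℚ) /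
          ((Nat.factorial ((m + d) / 2) : ℚ) * (Nat.factorial ((m - 1 - d) / 2) : ℚ))) *
        ((Nat.factorial n : ℚ) /
          ((Nat.factorial ((n + d) / 2) : ℚ) * (Nat.factorial ((n - 1 - d) / 2) : ℚ))) := by
  obtain ⟨k, hk⟩ : ∃ k, min m n = d + 1 + k := ⟨min m n - (d + 1), by omega⟩
  obtain ⟨s, hs⟩ := hmn
  induction k generalizing d with
  | zero =>
    obtain ⟨a, ha⟩ : ∃ a, m = d + 1 + 2 * a := ⟨(m - (d + 1)) / 2, by omega⟩
    obtain ⟨b, hb⟩ : ∃ b, n = d + 1 + 2 * b := ⟨(n - (d + 1)) / 2, by omega⟩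
    have hab : a = 0 ∨ b = 0 := by omega
    rw [hk, add_zero, Finset.Icc_self, Finset.sum_singleton, if_pos (by omega),
      show (m - (d + 1)) / 2 = a by omega, show (n + (d + 1)) / 2 = d + 1 + b by omega,
      show (m + d) / 2 = d + a by omega, show (n + d) / 2 = d + b by omega,
      show (m - 1 - d) / 2 = a by omega, show (n - 1 - d) / 2 = b by omega, ha, hb,
      mul_choose_mul_choose_eq_sub]
    rcases hab with rfl | rfl <;> simp
  | succ k ih =>
    have hsplit : Finset.Icc (d + 1) (min m n) =
        insert (d + 1) (Finset.Icc (d + 1 + 1) (min m n)) := by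
      ext x
      simp only [Finset.mem_Icc, Finset.mem_insert]
      omega
    rw [hsplit, Finset.sum_insert (by simp),
      ih (d + 1) (by omega) (by omega) (by omega)]
    by_cases hpar : (d + 1) % 2 = m % 2
    · obtain ⟨a, ha⟩ : ∃ a, m = d + 1 + 2 * (a + 1) := ⟨(m - (d + 3)) / 2, by omega⟩
      obtain ⟨b, hb⟩ : ∃ b, n = d + 1 + 2 * (b + 1) := ⟨(n - (d + 3)) / 2, by omega⟩
      rw [if_pos hpar,
        show (m - (d + 1)) / 2 = a + 1 by omega,
        show (n + (d + 1)) / 2 = d + 1 + (b + 1) by omega,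
        show (m + d) / 2 = d + (a + 1) by omega, show (n + d) / 2 = d + (b + 1) by omega,
        show (m - 1 - d) / 2 = a + 1 by omega, show (n - 1 - d) / 2 = b + 1 by omega,
        show (m + (d + 1)) / 2 = d + 1 + (a + 1) by omega,
        show (m - 1 - (d + 1)) / 2 = a by omega, show (n - 1 - (d + 1)) / 2 = b by omega, ha, hb,
        mul_choose_mul_choose_eq_sub]
      have cancel (c : ℕ) (x y : ℚ) : ((c + 1 : ℕ) : ℚ) * x / (y * Nat.factorial (c + 1)) =
          x / (y * Nat.factorial c) := by
        rw [Nat.factorial_succ, Nat.cast_mul, mul_left_comm y,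
          mul_div_mul_left _ _ (by positivity)]
      rw [cancel, cancel, sub_add_cancel]
    · rw [if_neg hpar, zero_add,
        show (m + (d + 1)) / 2 = (m + d) / 2 by omega,
        show (n + (d + 1)) / 2 = (n + d) / 2 by omega,
        show (m - 1 - (d + 1)) / 2 = (m - 1 - d) / 2 by omega,
        show (n - 1 - (d + 1)) / 2 = (n - 1 - d) / 2 by omega]
end

section
/- For every n ∈ (0, 2), the rate function J satisfies: (i) J''(p) = 1/(p(1+p²)) for all p > 0; (ii) J(n/√(4−n²)) = 0; (iii) J(p) > 0 for every p > 0 with p ≠ n/√(4−n²); and (iv) lim_{p→0⁺} J(p) = arcsin(n/2). -/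
/-- The large-deviation rate function `J(p)` for nesting depth in the `O(n)` loop model,
with `arccot p = arctan (1/p)` for `p > 0`. -/
noncomputable def Jrate (n p : ℝ) : ℝ :=
  p * Real.log (2 * p / (n * Real.sqrt (1 + p ^ 2))) + Real.arctan (1 / p) -
    Real.arccos (n / 2)

theorem Jrate_eq_of_pos {n p : ℝ} (hn : 0 < n) (hp : 0 < p) :
    Jrate n p = p * Real.log (2 / n) + p * Real.log p - p * Real.log (Real.sqrt (1 + p ^ 2)) +
      (Real.pi / 2 - Real.arctan p) - Real.arccos (n / 2) := by
  have hs : 0 < Real.sqrt (1 + p ^ 2) := by positivity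
  have hlog : Real.log (2 * p / (n * Real.sqrt (1 + p ^ 2))) =
      Real.log (2 / n) + Real.log p - Real.log (Real.sqrt (1 + p ^ 2)) := by
    rw [mul_div_mul_comm, Real.log_mul (by positivity) (by positivity),
      Real.log_div hp.ne' hs.ne']
    ring
  rw [Jrate, hlog, one_div, Real.arctan_inv_of_pos hp]
  ring

theorem hasDerivAt_Jrate {n p : ℝ} (hn : 0 < n) (hp : 0 < p) :
    HasDerivAt (Jrate n)
      (Real.log (2 / n) + Real.log p - Real.log (1 + p ^ 2) / 2) p := by
  have hq : 0 < 1 + p ^ 2 := by positivity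
  have hlog : HasDerivAt (fun x : ℝ => Real.log (1 + x ^ 2)) (2 * p / (1 + p ^ 2)) p := by
    simpa using (((hasDerivAt_id p).pow 2).const_add 1).log hq.ne'
  have h := ((((hasDerivAt_id p).mul_const (Real.log (2 / n))).add
    (Real.hasDerivAt_mul_log hp.ne')).sub ((hasDerivAt_id p).mul (hlog.div_const 2))).add
    ((Real.hasDerivAt_arctan p).const_sub (Real.pi / 2)) |>.sub_const (Real.arccos (n / 2))
  refine (h.congr_of_eventuallyEq ?_).congr_deriv ?_
  · filter_upwards [eventually_gt_nhds hp] with x hx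
    rw [Jrate_eq_of_pos hn hx, Real.log_sqrt (by positivity)]
    rfl
  · simp only [id]
    field_simp
    ring

theorem deriv_deriv_Jrate {n p : ℝ} (hn : 0 < n) (hp : 0 < p) :
    deriv (deriv (Jrate n)) p = 1 / (p * (1 + p ^ 2)) := by
  have hq : 0 < 1 + p ^ 2 := by positivity
  have hlog : HasDerivAt (fun x : ℝ => Real.log (1 + x ^ 2)) (2 * p / (1 + p ^ 2)) p := by
    simpa using (((hasDerivAt_id p).pow 2).const_add 1).log hq.ne'
  have h := ((Real.hasDerivAt_log hp.ne').const_add (Real.log (2 / n))).sub (hlog.div_const 2)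
  refine ((h.congr_of_eventuallyEq ?_).congr_deriv ?_).deriv
  · filter_upwards [eventually_gt_nhds hp] with x hx
    exact (hasDerivAt_Jrate hn hx).deriv
  · field_simp
    ring

theorem strictConvexOn_Jrate {n : ℝ} (hn : 0 < n) :
    StrictConvexOn ℝ (Set.Ioi 0) (Jrate n) := by
  refine strictConvexOn_of_deriv2_pos (convex_Ioi 0)
    (fun x hx => (hasDerivAt_Jrate hn hx).continuousAt.continuousWithinAt) fun x hx => ?_
  rw [interior_Ioi] at hx
  have hx : 0 < x := hx
  rw [Function.iterate_succ, Function.iterate_one, Function.comp_apply, deriv_deriv_Jrate hn hx]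
  positivity

theorem tendsto_Jrate_zero {n : ℝ} (hn : 0 < n) :
    Filter.Tendsto (Jrate n) (nhdsWithin 0 (Set.Ioi 0)) (nhds (Real.arcsin (n / 2))) := by
  have hc : Continuous fun p : ℝ =>
      p * Real.log (2 / n) + p * Real.log p - p * Real.log (Real.sqrt (1 + p ^ 2)) +
        (Real.pi / 2 - Real.arctan p) - Real.arccos (n / 2) := by
    have h1 := Real.continuous_mul_log
    have h2 : Continuous fun p : ℝ => Real.log (Real.sqrt (1 + p ^ 2)) :=
      Continuous.log (by fun_prop) fun p => by positivity
    fun_prop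
  have h := (hc.tendsto 0).mono_left (nhdsWithin_le_nhds (s := Set.Ioi 0))
  have h0 : Real.pi / 2 - Real.arccos (n / 2) = Real.arcsin (n / 2) := by
    rw [Real.arccos]; ring
  simp only [zero_mul, Real.arctan_zero, sub_zero, add_zero, zero_add, h0] at h
  refine h.congr' ?_
  filter_upwards [self_mem_nhdsWithin] with p hp
  exact (Jrate_eq_of_pos hn hp).symm

theorem Jrate_properties (n : ℝ) (hn0 : 0 < n) (hn2 : n < 2) :
    (∀ p : ℝ, 0 < p → deriv (deriv (Jrate n)) p = 1 / (p * (1 + p ^ 2))) ∧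
    Jrate n (n / Real.sqrt (4 - n ^ 2)) = 0 ∧
    (∀ p : ℝ, 0 < p → p ≠ n / Real.sqrt (4 - n ^ 2) → 0 < Jrate n p) ∧
    Filter.Tendsto (Jrate n) (nhdsWithin 0 (Set.Ioi 0)) (nhds (Real.arcsin (n / 2))) := by
  have hd : 0 < 4 - n ^ 2 := by nlinarith
  have hs : 0 < Real.sqrt (4 - n ^ 2) := Real.sqrt_pos.2 hd
  set q := n / Real.sqrt (4 - n ^ 2) with hq
  have hq0 : 0 < q := by positivity
  have hsqrt : Real.sqrt (1 + q ^ 2) = 2 / n * q := by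
    rw [Real.sqrt_eq_iff_mul_self_eq (by positivity) (by positivity), hq]
    field_simp
    rw [Real.sq_sqrt hd.le]
    ring
  have hlog : Real.log (Real.sqrt (1 + q ^ 2)) = Real.log (2 / n) + Real.log q := by
    rw [hsqrt, Real.log_mul (by positivity) hq0.ne']
  have hzero : Jrate n q = 0 := by
    have harc : q / Real.sqrt (1 + q ^ 2) = n / 2 := by
      rw [hsqrt]
      field_simp
    rw [Jrate_eq_of_pos hn0 hq0, hlog, Real.arctan_eq_arcsin, harc, Real.arccos]
    ring
  have hderiv : HasDerivAt (Jrate n) 0 q := by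
    refine (hasDerivAt_Jrate hn0 hq0).congr_deriv ?_
    rw [← Real.log_sqrt (by positivity), hlog, sub_self]
  refine ⟨fun p hp => deriv_deriv_Jrate hn0 hp, hzero, fun p hp hne => ?_,
    tendsto_Jrate_zero hn0⟩
  have hconv := strictConvexOn_Jrate hn0
  rcases lt_or_gt_of_ne hne with hlt | hlt
  · have h := hconv.slope_lt_of_hasDerivAt hp hq0 hlt hderiv
    rw [slope_def_field, hzero, div_lt_iff₀ (sub_pos.2 hlt)] at h
    linarith
  · have h := hconv.lt_slope_of_hasDerivAt hq0 hp hlt hderiv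
    rw [slope_def_field, hzero, lt_div_iff₀ (sub_pos.2 hlt)] at h
    linarith
end

section
/- For every n ∈ (0, 2) and every p > 0, J(p) = sup{ p·t + arccos(n·e^t/2) − arccos(n/2) : t ∈ (−∞, ln(2/n)) }; that is, J is the Legendre–Fenchel transform of the function t ↦ arccos(n/2) − arccos(n·e^t/2) on (−∞, ln(2/n)), and the supremum is attained at t = ln( 2p/(n·√(1+p²)) ). -/
theorem exp_mul_cos_sub_le_one_of_nonneg (q : ℝ) {x : ℝ} (hx : 0 ≤ x) (hxπ : x ≤ Real.pi) :
    Real.exp (q * x) * (Real.cos x - q * Real.sin x) ≤ 1 := by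
  have hd : ∀ y : ℝ, HasDerivAt (fun y => Real.exp (q * y) * (Real.cos y - q * Real.sin y))
      (-((1 + q ^ 2) * Real.exp (q * y) * Real.sin y)) y := by
    intro y
    have he : HasDerivAt (fun y => Real.exp (q * y)) (Real.exp (q * y) * q) y := by
      simpa using ((hasDerivAt_id' y).const_mul q).exp
    have ht : HasDerivAt (fun y => Real.cos y - q * Real.sin y)
        (-Real.sin y - q * Real.cos y) y :=
      (Real.hasDerivAt_cos y).sub ((Real.hasDerivAt_sin y).const_mul q)
    exact (he.mul ht).congr_deriv (by ring)
  have hanti : AntitoneOn (fun y => Real.exp (q * y) * (Real.cos y - q * Real.sin y))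
      (Set.Icc 0 Real.pi) := by
    refine antitoneOn_of_deriv_nonpos (convex_Icc _ _)
      (fun y _ => (hd y).continuousAt.continuousWithinAt)
      (fun y _ => (hd y).differentiableAt.differentiableWithinAt) fun y hy => ?_
    rw [interior_Icc] at hy
    rw [(hd y).deriv]
    have := Real.sin_pos_of_pos_of_lt_pi hy.1 hy.2
    have : 0 < (1 + q ^ 2) * Real.exp (q * y) * Real.sin y := by positivity
    linarith
  simpa using hanti ⟨le_rfl, Real.pi_pos.le⟩ ⟨hx, hxπ⟩ hx

theorem exp_mul_cos_sub_le_one (q : ℝ) {x : ℝ} (hx : |x| ≤ Real.pi) :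
    Real.exp (q * x) * (Real.cos x - q * Real.sin x) ≤ 1 := by
  rcases le_total 0 x with h | h
  · exact exp_mul_cos_sub_le_one_of_nonneg q h (abs_le.1 hx).2
  · simpa using exp_mul_cos_sub_le_one_of_nonneg (-q) (neg_nonneg.2 h)
      (neg_le.1 (abs_le.1 hx).1)

theorem cos_arctan_one_div {p : ℝ} (hp : 0 < p) :
    Real.cos (Real.arctan (1 / p)) = p / Real.sqrt (1 + p ^ 2) := by
  have h : 1 + (1 / p) ^ 2 = (1 + p ^ 2) / p ^ 2 := by field_simp; ring
  rw [Real.cos_arctan, h, Real.sqrt_div (by positivity), Real.sqrt_sq hp.le, one_div_div]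

/-- The tangent-line bound for the concave function `y ↦ p * log (cos y)` at `arctan (1 / p)`. -/
theorem mul_log_add_arccos_le {p y : ℝ} (hp : 0 < p) (hy0 : 0 < y) (hy1 : y ≤ 1) :
    p * Real.log y + Real.arccos y ≤
      p * Real.log (Real.cos (Real.arctan (1 / p))) + Real.arctan (1 / p) := by
  set a := Real.arctan (1 / p) with ha
  set d := Real.arccos y - a with hd
  have ha0 : 0 < a := Real.arctan_pos.2 (by positivity)
  have ha1 : a < Real.pi / 2 := Real.arctan_lt_pi_div_two _
  have hc : 0 < Real.cos a := Real.cos_arctan_pos _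
  have hs : Real.sin a = 1 / p * Real.cos a := by
    rw [← Real.tan_mul_cos hc.ne', ha, Real.tan_arctan]
  have hdπ : |d| ≤ Real.pi := by
    have h0 := Real.arccos_nonneg y
    have h1 := Real.arccos_le_pi y
    rw [abs_le]
    constructor <;> linarith
  have hy : y = Real.cos a * (Real.cos d - 1 / p * Real.sin d) := by
    have h : Real.cos (a + d) = y := by
      rw [hd, add_sub_cancel, Real.cos_arccos (by linarith) hy1]
    rw [← h, Real.cos_add, hs]
    ring
  have hle : Real.exp (1 / p * d) * y ≤ Real.cos a := by
    have := mul_le_mul_of_nonneg_left (exp_mul_cos_sub_le_one (1 / p) hdπ) hc.le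
    calc Real.exp (1 / p * d) * y
        = Real.cos a * (Real.exp (1 / p * d) * (Real.cos d - 1 / p * Real.sin d)) := by
          conv_lhs => rw [hy]
          ring
      _ ≤ Real.cos a := by linarith
  have hlog := Real.log_le_log (by positivity) hle
  rw [Real.log_mul (Real.exp_pos _).ne' hy0.ne', Real.log_exp] at hlog
  have := mul_le_mul_of_nonneg_left hlog hp.le
  have hpd : p * (1 / p * d) = d := by field_simp
  linarith

theorem Jrate_legendre (n p : ℝ) (hn0 : 0 < n) (hn2 : n < 2) (hp : 0 < p) :
    IsGreatest
      ((fun t : ℝ => p * t + Real.arccos (n * Real.exp t / 2) - Real.arccos (n / 2)) ''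
        Set.Iio (Real.log (2 / n)))
      (Jrate n p) ∧
    Real.log (2 * p / (n * Real.sqrt (1 + p ^ 2))) ∈ Set.Iio (Real.log (2 / n)) ∧
    p * Real.log (2 * p / (n * Real.sqrt (1 + p ^ 2))) +
        Real.arccos (n * Real.exp (Real.log (2 * p / (n * Real.sqrt (1 + p ^ 2)))) / 2) -
        Real.arccos (n / 2) =
      Jrate n p := by
  have ha0 : 0 < Real.arctan (1 / p) := Real.arctan_pos.2 (by positivity)
  have ha1 : Real.arctan (1 / p) < Real.pi / 2 := Real.arctan_lt_pi_div_two _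
  have hc : 0 < Real.cos (Real.arctan (1 / p)) := Real.cos_arctan_pos _
  have hc1 : Real.cos (Real.arctan (1 / p)) < 1 := by
    simpa using Real.cos_lt_cos_of_nonneg_of_le_pi le_rfl (by linarith [Real.pi_pos]) ha0
  have hT : 2 * p / (n * Real.sqrt (1 + p ^ 2)) =
      2 / n * Real.cos (Real.arctan (1 / p)) := by
    rw [cos_arctan_one_div hp, div_mul_div_comm]
  have hmem : Real.log (2 * p / (n * Real.sqrt (1 + p ^ 2))) ∈ Set.Iio (Real.log (2 / n)) := by
    rw [hT]
    exact Real.log_lt_log (by positivity) (mul_lt_of_lt_one_right (by positivity) hc1)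
  have hval : p * Real.log (2 * p / (n * Real.sqrt (1 + p ^ 2))) +
        Real.arccos (n * Real.exp (Real.log (2 * p / (n * Real.sqrt (1 + p ^ 2)))) / 2) -
        Real.arccos (n / 2) = Jrate n p := by
    have h : n * (2 / n * Real.cos (Real.arctan (1 / p))) / 2 =
        Real.cos (Real.arctan (1 / p)) := by field_simp
    rw [Jrate, Real.exp_log (by positivity), hT, h, Real.arccos_cos ha0.le (by linarith)]
  refine ⟨⟨⟨_, hmem, hval⟩, ?_⟩, hmem, hval⟩
  rintro _ ⟨t, ht, rfl⟩
  have hexp : Real.exp t < 2 / n := (Real.lt_log_iff_exp_lt (by positivity)).1 ht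
  have hy1 : n * Real.exp t / 2 ≤ 1 := by
    rw [lt_div_iff₀ hn0] at hexp
    linarith
  have hbound := mul_log_add_arccos_le hp (y := n * Real.exp t / 2) (by positivity) hy1
  have hlog : Real.log (n * Real.exp t / 2) = t - Real.log (2 / n) := by
    rw [Real.log_div (by positivity) two_ne_zero, Real.log_mul hn0.ne' (Real.exp_pos t).ne',
      Real.log_exp, Real.log_div two_ne_zero hn0.ne']
    ring
  rw [hlog] at hbound
  simp only [Jrate]
  rw [hT, Real.log_mul (by positivity) hc.ne']
  linarith
end

section
/- Let 0 < q < 1 and t > 0. For every partition λ and every c ∈ ℤ, the sets (S(λ)+c) ∩ (0,∞) and ((ℤ+1/2) ∖ (S(λ)+c)) ∩ (−∞,0) are finite, and q^{|λ| + c²/2}·t^c = ∏_{s ∈ (S(λ)+c), s > 0} (q^s·t) · ∏_{s ∈ (ℤ+1/2) ∖ (S(λ)+c), s < 0} (q^{−s}·t^{−1}). -/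
/-- An integer partition: a weakly decreasing sequence of nonnegative integers with only
finitely many nonzero terms; `part i` is the `(i+1)`-st part `λ_{i+1}`. -/
structure IntPartition where
  part : ℕ → ℕ
  antitone : Antitone part
  finite_supp : (Function.support part).Finite

/-- The size `|λ| = Σ_i λ_i` of a partition. -/
noncomputable def IntPartition.size (lam : IntPartition) : ℕ := ∑ᶠ i, lam.part i

/-- The set `ℤ + 1/2` of half-integers, as a subset of `ℝ`. -/
def halfInts : Set ℝ := {x | ∃ m : ℤ, x = (m : ℝ) + 1 / 2}

/-- The shifted Maya diagram `S(λ) + c = { λ_i − i + 1/2 + c : i ≥ 1 }`, as a subset of `ℝ`. -/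
def shiftedS (lam : IntPartition) (c : ℤ) : Set ℝ :=
  {x | ∃ i : ℕ, x = (lam.part i : ℝ) - (i : ℝ) - 1 / 2 + (c : ℝ)}

namespace IntPartition

/-- The element `λ_{i+1} − (i+1) + 1/2 + c` of the shifted Maya diagram. -/
noncomputable def bead (lam : IntPartition) (c : ℤ) (i : ℕ) : ℝ :=
  (lam.part i : ℝ) - (i : ℝ) - 1 / 2 + (c : ℝ)

theorem bead_injective (lam : IntPartition) (c : ℤ) : Function.Injective (lam.bead c) := by
  have h : StrictAnti (lam.bead c) := by
    intro i j hij
    have h1 : (lam.part j : ℝ) ≤ lam.part i := by exact_mod_cast lam.antitone hij.le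
    have h2 : (i : ℝ) < j := by exact_mod_cast hij
    unfold bead
    linarith
  exact h.injective

/-- The first `N` elements of the shifted Maya diagram. -/
noncomputable def beads (lam : IntPartition) (c : ℤ) (N : ℕ) : Finset ℝ :=
  (Finset.range N).image (lam.bead c)

theorem exists_part_eq_zero (lam : IntPartition) : ∃ N : ℕ, ∀ i, N ≤ i → lam.part i = 0 := by
  obtain ⟨N, hN⟩ := lam.finite_supp.bddAbove
  refine ⟨N + 1, fun i hi => ?_⟩
  by_contra h
  have : i ≤ N := hN h
  omega

theorem size_eq_sum (lam : IntPartition) {N : ℕ} (hN : ∀ i, N ≤ i → lam.part i = 0) :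
    lam.size = ∑ i ∈ Finset.range N, lam.part i := by
  refine finsum_eq_sum_of_support_subset _ fun i hi => ?_
  by_contra h
  exact hi (hN i (by simpa using h))

end IntPartition

/-- The `M` largest negative half-integers. -/
noncomputable def negHalfInts (M : ℕ) : Finset ℝ :=
  (Finset.range M).image fun j : ℕ => -(j : ℝ) - 1 / 2

theorem sum_range_cast_add_half (N : ℕ) :
    ∑ i ∈ Finset.range N, ((i : ℝ) + 1 / 2) = (N : ℝ) ^ 2 / 2 := by
  induction N with
  | zero => simp
  | succ n ih => rw [Finset.sum_range_succ, ih]; push_cast; ring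

theorem prod_negHalfInts {q : ℝ} (hq : 0 < q) (t : ℝ) (M : ℕ) :
    ∏ s ∈ negHalfInts M, q ^ s * t = q ^ (-((M : ℝ) ^ 2 / 2)) * t ^ M := by
  have hinj : Function.Injective fun j : ℕ => -(j : ℝ) - 1 / 2 := by
    intro i j h
    have h' : (i : ℝ) = j := by simpa using h
    exact_mod_cast h'
  rw [negHalfInts, Finset.prod_image hinj.injOn, Finset.prod_mul_distrib, Finset.prod_const,
    Finset.card_range, ← Real.rpow_sum_of_pos hq, ← sum_range_cast_add_half,
    ← Finset.sum_neg_distrib]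
  congr 2
  exact Finset.sum_congr rfl fun i _ => by ring

namespace IntPartition

theorem prod_beads {q : ℝ} (hq : 0 < q) (t : ℝ) (lam : IntPartition) (c : ℤ) {N : ℕ}
    (hN : ∀ i, N ≤ i → lam.part i = 0) :
    ∏ s ∈ lam.beads c N, q ^ s * t =
      q ^ ((lam.size : ℝ) - (N : ℝ) ^ 2 / 2 + N * c) * t ^ N := by
  rw [beads, Finset.prod_image (lam.bead_injective c).injOn, Finset.prod_mul_distrib,
    Finset.prod_const, Finset.card_range, ← Real.rpow_sum_of_pos hq, ← sum_range_cast_add_half,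
    lam.size_eq_sum hN]
  congr 2
  have h : (N : ℝ) * c = ∑ _i ∈ Finset.range N, (c : ℝ) := by simp
  push_cast
  rw [h, ← Finset.sum_sub_distrib, ← Finset.sum_add_distrib]
  exact Finset.sum_congr rfl fun i _ => by unfold bead; ring

variable {lam : IntPartition} {c : ℤ} {N M : ℕ}

theorem shiftedS_inter_Ioi (hN : ∀ i, N ≤ i → lam.part i = 0) (hM : (M : ℤ) = N - c) :
    shiftedS lam c ∩ Set.Ioi (0 : ℝ) = ↑(lam.beads c N \ negHalfInts M) := by
  ext x
  simp only [Set.mem_inter_iff, Set.mem_Ioi, Finset.coe_sdiff, Set.mem_sdiff, Finset.mem_coe,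
    beads, negHalfInts, Finset.mem_image, Finset.mem_range, not_exists, not_and]
  constructor
  · rintro ⟨⟨i, rfl⟩, hx⟩
    refine ⟨⟨i, ?_, rfl⟩, fun j _ h => ?_⟩
    · by_contra! hi
      have h1 : (c : ℝ) ≤ i := by exact_mod_cast (by omega : c ≤ i)
      rw [hN i hi] at hx
      norm_num at hx
      linarith
    · have : (0 : ℝ) ≤ j := j.cast_nonneg
      linarith
  · rintro ⟨⟨i, hi, rfl⟩, h⟩
    refine ⟨⟨i, rfl⟩, ?_⟩
    by_contra! hx
    have h1 : (lam.part i : ℤ) - i + c < 1 := by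
      have : (lam.part i : ℝ) - i + c < 1 := by unfold bead at hx; linarith
      exact_mod_cast this
    obtain ⟨j, hj⟩ := Int.eq_ofNat_of_zero_le (by omega : 0 ≤ (i : ℤ) - lam.part i - c)
    have hj' : (i : ℝ) - lam.part i - c = j := by exact_mod_cast hj
    exact h j (by omega) (by unfold bead; linarith)

theorem halfInts_diff_shiftedS_inter_Iio (hN : ∀ i, N ≤ i → lam.part i = 0)
    (hM : (M : ℤ) = N - c) :
    (halfInts \ shiftedS lam c) ∩ Set.Iio (0 : ℝ) = ↑(negHalfInts M \ lam.beads c N) := by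
  ext x
  simp only [Set.mem_inter_iff, Set.mem_Iio, Finset.coe_sdiff, Set.mem_sdiff, Finset.mem_coe,
    beads, negHalfInts, Finset.mem_image, Finset.mem_range, not_exists, not_and]
  constructor
  · rintro ⟨⟨⟨m, rfl⟩, hS⟩, hx⟩
    refine ⟨?_, fun i _ h => hS ⟨i, h.symm⟩⟩
    have hm : m < 0 := by
      have : (m : ℝ) < 0 := by linarith
      exact_mod_cast this
    obtain ⟨j, hj⟩ := Int.eq_ofNat_of_zero_le (by omega : 0 ≤ -m - 1)
    have hj' : -(m : ℝ) - 1 = j := by exact_mod_cast hj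
    refine ⟨j, ?_, by linarith⟩
    by_contra! hjM
    obtain ⟨i, hi⟩ := Int.eq_ofNat_of_zero_le (by omega : 0 ≤ (j : ℤ) + c)
    have hi' : (j : ℝ) + c = i := by exact_mod_cast hi
    refine hS ⟨i, ?_⟩
    rw [hN i (by omega), Nat.cast_zero]
    linarith
  · rintro ⟨⟨j, hj, rfl⟩, h⟩
    refine ⟨⟨⟨-j - 1, by push_cast; ring⟩, ?_⟩, ?_⟩
    · rintro ⟨i, hi⟩
      by_cases hiN : i < N
      · exact h i hiN hi.symm
      · rw [hN i (by omega), Nat.cast_zero] at hi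
        have h1 : (j : ℝ) = i - c := by linarith
        have h2 : (j : ℤ) = i - c := by exact_mod_cast h1
        omega
    · have : (0 : ℝ) ≤ j := j.cast_nonneg
      linarith

end IntPartition

theorem Finset.prod_sdiff_mul_prod_sdiff_inv {ι K : Type*} [DecidableEq ι] [Field K]
    (A B : Finset ι) (g : ι → K) (hg : ∀ s, g s ≠ 0) :
    (∏ s ∈ A \ B, g s) * ∏ s ∈ B \ A, (g s)⁻¹ = (∏ s ∈ A, g s) / ∏ s ∈ B, g s := by
  have h : ∏ s ∈ A ∩ B, g s ≠ 0 := Finset.prod_ne_zero_iff.2 fun s _ => hg s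
  have h' : ∏ s ∈ B \ A, g s ≠ 0 := Finset.prod_ne_zero_iff.2 fun s _ => hg s
  rw [← Finset.prod_inter_mul_prod_sdiff A B, ← Finset.prod_inter_mul_prod_sdiff B A,
    Finset.inter_comm B A, Finset.prod_inv_distrib]
  field_simp

theorem maya_factorization (q t : ℝ) (hq0 : 0 < q) (hq1 : q < 1) (ht : 0 < t)
    (lam : IntPartition) (c : ℤ) :
    (shiftedS lam c ∩ Set.Ioi (0 : ℝ)).Finite ∧
    ((halfInts \ shiftedS lam c) ∩ Set.Iio (0 : ℝ)).Finite ∧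
    q ^ ((lam.size : ℝ) + (c : ℝ) ^ 2 / 2) * t ^ c =
      (∏ᶠ s ∈ shiftedS lam c ∩ Set.Ioi (0 : ℝ), q ^ s * t) *
        ∏ᶠ s ∈ (halfInts \ shiftedS lam c) ∩ Set.Iio (0 : ℝ), q ^ (-s) * t⁻¹ := by
  obtain ⟨N₀, hN₀⟩ := lam.exists_part_eq_zero
  obtain ⟨N, hNN₀, hNc⟩ : ∃ N : ℕ, N₀ ≤ N ∧ c ≤ N := ⟨N₀ + c.toNat, by omega, by omega⟩
  have hN : ∀ i, N ≤ i → lam.part i = 0 := fun i hi => hN₀ i (hNN₀.trans hi)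
  obtain ⟨M, hM'⟩ := Int.eq_ofNat_of_zero_le (by omega : 0 ≤ (N : ℤ) - c)
  have hM : (M : ℤ) = N - c := hM'.symm
  rw [IntPartition.shiftedS_inter_Ioi hN hM, IntPartition.halfInts_diff_shiftedS_inter_Iio hN hM]
  refine ⟨Finset.finite_toSet _, Finset.finite_toSet _, ?_⟩
  have hinv : ∀ s : ℝ, q ^ (-s) * t⁻¹ = (q ^ s * t)⁻¹ := fun s => by
    rw [Real.rpow_neg hq0.le, mul_inv]
  have hMR : (M : ℝ) = N - c := by exact_mod_cast hM
  have hc : c = (N : ℤ) - M := by omega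
  simp only [hinv]
  rw [finprod_mem_coe_finset, finprod_mem_coe_finset,
    Finset.prod_sdiff_mul_prod_sdiff_inv _ _ _ fun s => by positivity,
    lam.prod_beads hq0 t c hN, prod_negHalfInts hq0, mul_div_mul_comm, ← Real.rpow_sub hq0,
    ← zpow_natCast t N, ← zpow_natCast t M, ← zpow_sub₀ ht.ne', ← hc, hMR]
  congr 2
  ring
end

section
/- Let 0 < q < 1 and t > 0. For every finite subset A ⊂ ℤ + 1/2, ( Σ_{c ∈ ℤ} Σ_{λ : A ⊆ S(λ)+c} q^{|λ| + c²/2}·t^c ) / ( Σ_{c ∈ ℤ} Σ_{λ} q^{|λ| + c²/2}·t^c ) = ∏_{s ∈ A} q^s·t/(1 + q^s·t), where both sums run over all pairs of a partition λ and an integer c, and both sums are finite. In other words, under the shift-mixed grand canonical measure on pairs (λ, c) with weight proportional to q^{|λ|+c²/2} t^c, the events { s ∈ S(λ)+c } for s ∈ ℤ+1/2 are independent with Fermi–Dirac probabilities q^s t/(1+q^s t). -/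
/-- The sites `λ_i − i + c`, so that `shiftedS lam c` consists of the `m + 1/2` with `m` a site;
the sites are enumerated in decreasing order. -/
def IntPartition.site (lam : IntPartition) (c : ℤ) (i : ℕ) : ℤ := lam.part i - i - 1 + c

theorem IntPartition.site_strictAnti (lam : IntPartition) (c : ℤ) : StrictAnti (lam.site c) := by
  intro i j hij
  have := lam.antitone hij.le
  simp only [IntPartition.site]
  omega

theorem IntPartition.exists_forall_part_eq_zero (lam : IntPartition) :
    ∃ n, ∀ i ≥ n, lam.part i = 0 := by
  obtain ⟨b, hb⟩ := lam.finite_supp.bddAbove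
  refine ⟨b + 1, fun i hi => ?_⟩
  by_contra h
  have := hb h
  omega

theorem IntPartition.mem_range_site_of_lt (lam : IntPartition) (c : ℤ) {n : ℕ}
    (hn : ∀ i ≥ n, lam.part i = 0) {m : ℤ} (hm : m < c - n) : m ∈ Set.range (lam.site c) := by
  refine ⟨(c - 1 - m).toNat, ?_⟩
  have := hn (c - 1 - m).toNat (by omega)
  simp only [IntPartition.site, this]
  omega

theorem IntPartition.finite_setOf_excited (lam : IntPartition) (c : ℤ) :
    {m | m ∈ Set.range (lam.site c) ↔ 0 ≤ m}.Finite := by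
  obtain ⟨n, hn⟩ := lam.exists_forall_part_eq_zero
  refine (Set.finite_Icc (min 0 (c - n)) (max 0 (lam.site c 0))).subset fun m hm => ?_
  rw [Set.mem_Icc]
  by_cases h : 0 ≤ m
  · obtain ⟨i, rfl⟩ := (show _ ↔ _ from hm).2 h
    have := (lam.site_strictAnti c).antitone (Nat.zero_le i)
    omega
  · have : ¬ m < c - n := fun h' => h ((show _ ↔ _ from hm).1 (lam.mem_range_site_of_lt c hn h'))
    omega

/-- The excitations of `(λ, c)`: the occupied sites `m ≥ 0` and the empty sites `m < 0`. -/
noncomputable def excitations (lc : IntPartition × ℤ) : Finset ℤ :=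
  (lc.1.finite_setOf_excited lc.2).toFinset

theorem mem_excitations {lc : IntPartition × ℤ} {m : ℤ} :
    m ∈ excitations lc ↔ (m ∈ Set.range (lc.1.site lc.2) ↔ 0 ≤ m) := by
  simp [excitations]

theorem mem_range_site_iff {lc : IntPartition × ℤ} {m : ℤ} :
    m ∈ Set.range (lc.1.site lc.2) ↔ (m ∈ excitations lc ↔ 0 ≤ m) := by
  rw [mem_excitations]
  tauto

theorem excitations_injective : Function.Injective excitations := by
  rintro ⟨lam, c⟩ ⟨mu, d⟩ h
  have hr : Set.range (lam.site c) = Set.range (mu.site d) := by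
    ext m
    rw [mem_range_site_iff (lc := (lam, c)), mem_range_site_iff (lc := (mu, d)), h]
  have hs : lam.site c = mu.site d := by
    have hneg : (fun i => - lam.site c i) = fun i => - mu.site d i := by
      refine (StrictMono.range_inj (fun i j hij => neg_lt_neg (lam.site_strictAnti c hij))
        (fun i j hij => neg_lt_neg (mu.site_strictAnti d hij))).1 ?_
      rw [Set.range_comp' Neg.neg (lam.site c), hr, ← Set.range_comp']
    funext i
    exact neg_injective (congrFun hneg i)
  obtain ⟨n, hn⟩ := lam.exists_forall_part_eq_zero
  obtain ⟨k, hk⟩ := mu.exists_forall_part_eq_zero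
  have hc : c = d := by
    have h1 := congrFun hs (n + k)
    simp only [IntPartition.site, hn (n + k) (by omega), hk (n + k) (by omega)] at h1
    omega
  subst hc
  have hp : lam.part = mu.part := by
    funext i
    have h1 := congrFun hs i
    simp only [IntPartition.site] at h1
    omega
  cases lam
  cases mu
  simp_all

theorem excitations_surjective : Function.Surjective excitations := by
  intro D
  obtain ⟨K, hK⟩ : ∃ K : ℕ, ∀ m ∈ D, m.natAbs ≤ K := by
    exact ⟨D.sup Int.natAbs, fun m hm => Finset.le_sup (f := Int.natAbs) hm⟩
  set p : ℕ → Prop := fun n => ((K : ℤ) - n ∈ D ↔ 0 ≤ (K : ℤ) - n) with hp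
  have hlarge : ∀ n > 2 * K, p n := fun n hn =>
    iff_of_false (fun h => by have := hK _ h; omega) (by omega)
  have hinf : {n | p n}.Infinite :=
    (Set.Ioi_infinite (2 * K)).mono hlarge
  set e := Nat.nth p
  have hmono : StrictMono e := Nat.nth_strictMono hinf
  have hrange : Set.range e = {n | p n} := Nat.range_nth_of_infinite hinf
  have hstep : ∀ i > 2 * K, e (i + 1) = e i + 1 := by
    intro i hi
    have h1 : p (e i + 1) := hlarge _ (by have := hmono.le_apply (x := i); omega)
    obtain ⟨j, hj⟩ : e i + 1 ∈ Set.range e := hrange ▸ h1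
    have h2 : i < j := hmono.lt_iff_lt.1 (by omega)
    have h3 := hmono.monotone (show i + 1 ≤ j from h2)
    have h4 := hmono (Nat.lt_succ_self i)
    simp only [Nat.succ_eq_add_one] at h4
    omega
  have hsub : Monotone fun i => (e i : ℤ) - i := by
    refine monotone_nat_of_le_succ fun i => ?_
    have := hmono (Nat.lt_succ_self i)
    simp only [Nat.succ_eq_add_one] at this
    push_cast
    omega
  set L := 2 * K + 1 with hL
  have hconst : ∀ i ≥ L, (e i : ℤ) - i = e L - L := by
    intro i hi
    induction i, hi using Nat.le_induction with
    | base => rfl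
    | succ i hi ih =>
      have := hstep i (by omega)
      push_cast
      omega
  have hle : ∀ i, (e i : ℤ) - i ≤ e L - L := by
    intro i
    rcases le_total i L with h | h
    · exact hsub h
    · exact (hconst i h).le
  let lam : IntPartition :=
    { part := fun i => ((e L : ℤ) - L - (e i - i)).toNat
      antitone := fun i j hij => by
        have := hsub hij
        beta_reduce at this ⊢
        omega
      finite_supp := by
        refine (Set.finite_Iio L).subset fun i hi => ?_
        by_contra h
        have := hconst i (not_lt.1 h)
        apply hi
        simp only
        omega }
  have hsite : ∀ i, lam.site (K - e L + L + 1) i = K - e i := by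
    intro i
    have := hle i
    simp only [IntPartition.site, lam]
    omega
  refine ⟨(lam, K - e L + L + 1), ?_⟩
  ext m
  have hmem : m ∈ Set.range (lam.site (K - e L + L + 1)) ↔ (m ∈ D ↔ 0 ≤ m) := by
    constructor
    · rintro ⟨i, rfl⟩
      have h1 : p (e i) := by
        have : e i ∈ Set.range e := ⟨i, rfl⟩
        rwa [hrange] at this
      rw [hsite]
      exact h1
    · intro h
      have hmK : m ≤ K := by
        by_contra h'
        have := hK m (h.2 (by omega))
        omega
      have h1 : p (K - m).toNat := by
        have h2 : (K : ℤ) - ((K - m).toNat : ℕ) = m := by omega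
        simp only [hp, h2]
        exact h
      obtain ⟨i, hi⟩ : (K - m).toNat ∈ Set.range e := hrange ▸ h1
      exact ⟨i, by rw [hsite]; omega⟩
  rw [mem_excitations]
  simp only [hmem]
  tauto

/-- The product of `g` over the sites above a low enough cut-off. -/
theorem prod_site_eq {α : Type*} [Field α] (g : ℤ → α) (hg : ∀ m, g m ≠ 0)
    (lam : IntPartition) (c : ℤ) {n k : ℕ} (hn : ∀ i ≥ n, lam.part i = 0) (hk : (k : ℤ) = n - c) :
    ∏ i ∈ Finset.range n, g (lam.site c i) =
      (∏ j ∈ Finset.range k, g (-1 - j)) *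
        ∏ m ∈ excitations (lam, c), if 0 ≤ m then g m else (g m)⁻¹ := by
  classical
  set D := excitations (lam, c) with hD
  have hbelow : ∀ m ∈ D, -(k : ℤ) ≤ m := by
    intro m hm
    by_contra h
    have h1 := (mem_excitations.1 hm).1 (lam.mem_range_site_of_lt c hn (by omega))
    omega
  have h1 : ∏ j ∈ Finset.range k, g (-1 - j) = ∏ m ∈ Finset.Ico (-(k : ℤ)) 0, g m := by
    refine Finset.prod_bij (fun j _ => -1 - (j : ℤ)) ?_ ?_ ?_ ?_
    · intro j hj
      simp only [Finset.mem_range, Finset.mem_Ico] at *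
      omega
    · intro i _ j _ h
      omega
    · intro m hm
      simp only [Finset.mem_Ico] at hm
      exact ⟨(-1 - m).toNat, by simp only [Finset.mem_range]; omega, by omega⟩
    · intros
      rfl
  have h2 : ∏ i ∈ Finset.range n, g (lam.site c i) =
      ∏ m ∈ (D.filter (0 ≤ ·)) ∪ (Finset.Ico (-(k : ℤ)) 0 \ D), g m := by
    rw [← Finset.prod_image (g := lam.site c) (f := g)
      (fun i _ j _ h => (lam.site_strictAnti c).injective h)]
    congr 1
    ext m
    have hm := mem_range_site_iff (lc := (lam, c)) (m := m)
    have hm' : m ∈ (Finset.range n).image (lam.site c) ↔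
        m ∈ Set.range (lam.site c) ∧ -(k : ℤ) ≤ m := by
      simp only [Finset.mem_image, Finset.mem_range, Set.mem_range]
      have hsn : lam.site c n = -k - 1 := by
        simp only [IntPartition.site, hn n le_rfl]
        omega
      constructor
      · rintro ⟨i, hi, rfl⟩
        have := lam.site_strictAnti c hi
        exact ⟨⟨i, rfl⟩, by omega⟩
      · rintro ⟨⟨i, rfl⟩, hi⟩
        exact ⟨i, (lam.site_strictAnti c).lt_iff_gt.1 (by omega), rfl⟩
    have hb := hbelow m
    rw [hm', hm, ← hD]
    simp only [Finset.mem_union, Finset.mem_filter, Finset.mem_sdiff, Finset.mem_Ico]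
    by_cases hmD : m ∈ D
    · have := hb hmD
      simp only [hmD]
      tauto
    · simp only [hmD, false_iff, false_and, false_or, not_false_eq_true, and_true]
      omega
  have h3 : Finset.Ico (-(k : ℤ)) 0 ∩ D = D.filter (¬ 0 ≤ ·) := by
    ext m
    have hb := hbelow m
    simp only [Finset.mem_inter, Finset.mem_filter, Finset.mem_Ico]
    constructor
    · rintro ⟨h, h'⟩
      exact ⟨h', by omega⟩
    · rintro ⟨h, h'⟩
      exact ⟨⟨hb h, by omega⟩, h⟩
  have h4 : Disjoint (D.filter (0 ≤ ·)) (Finset.Ico (-(k : ℤ)) 0 \ D) := by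
    rw [Finset.disjoint_left]
    intro m hm hm'
    exact (Finset.mem_sdiff.1 hm').2 (Finset.mem_filter.1 hm).1
  rw [h1, h2, Finset.prod_union h4, Finset.prod_ite, ← Finset.prod_inter_mul_prod_sdiff
    (Finset.Ico (-(k : ℤ)) 0) D, h3, Finset.prod_inv_distrib]
  have h5 : ∏ m ∈ D.filter (¬ 0 ≤ ·), g m ≠ 0 := Finset.prod_ne_zero_iff.2 fun m _ => hg m
  field_simp

/-- The Boltzmann factor `q^s t` of a particle at `s = m + 1/2`. -/
noncomputable def siteWeight (q t : ℝ) (m : ℤ) : ℝ := q ^ ((m : ℝ) + 1 / 2) * t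

theorem siteWeight_pos {q t : ℝ} (hq : 0 < q) (ht : 0 < t) (m : ℤ) : 0 < siteWeight q t m :=
  mul_pos (Real.rpow_pos_of_pos hq _) ht

/-- The Boltzmann factor of an excitation at `m`: a particle if `0 ≤ m`, a hole otherwise. -/
noncomputable def excitationWeight (q t : ℝ) (m : ℤ) : ℝ :=
  if 0 ≤ m then siteWeight q t m else (siteWeight q t m)⁻¹

theorem excitationWeight_pos {q t : ℝ} (hq : 0 < q) (ht : 0 < t) (m : ℤ) :
    0 < excitationWeight q t m := by
  have := siteWeight_pos hq ht m
  unfold excitationWeight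
  split_ifs <;> positivity

theorem prod_siteWeight {q t : ℝ} (hq : 0 < q) (a : ℕ → ℕ) (c : ℤ) (n : ℕ) :
    ∏ i ∈ Finset.range n, siteWeight q t (a i - i - 1 + c) =
      q ^ (((∑ i ∈ Finset.range n, a i : ℕ) : ℝ) - (n : ℝ) ^ 2 / 2 + c * n) * t ^ n := by
  induction n with
  | zero => simp
  | succ n ih =>
    rw [Finset.prod_range_succ, ih, Finset.sum_range_succ, siteWeight, pow_succ, mul_mul_mul_comm,
      ← Real.rpow_add hq]
    congr 2
    push_cast
    ring

theorem prod_excitationWeight {q t : ℝ} (hq : 0 < q) (ht : 0 < t) (lam : IntPartition) (c : ℤ) :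
    ∏ m ∈ excitations (lam, c), excitationWeight q t m =
      q ^ ((lam.size : ℝ) + (c : ℝ) ^ 2 / 2) * t ^ c := by
  obtain ⟨n₀, hn₀⟩ := lam.exists_forall_part_eq_zero
  obtain ⟨n, hn, k, hk⟩ : ∃ n : ℕ, (∀ i ≥ n, lam.part i = 0) ∧ ∃ k : ℕ, (k : ℤ) = n - c :=
    ⟨n₀ + c.natAbs, fun i hi => hn₀ i (by omega), (n₀ + c.natAbs - c).toNat, by omega⟩
  have hsize : lam.size = ∑ i ∈ Finset.range n, lam.part i := by
    refine finsum_eq_sum_of_support_subset _ fun i hi => ?_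
    simp only [Finset.coe_range, Set.mem_Iio]
    by_contra h
    exact hi (hn i (not_lt.1 h))
  have hmain := prod_site_eq (siteWeight q t) (fun m => (siteWeight_pos hq ht m).ne') lam c hn hk
  have hsea := prod_siteWeight (t := t) hq (fun _ => 0) 0 k
  have hsea' : ∀ j : ℕ, ((0 : ℕ) : ℤ) - j - 1 + 0 = -1 - j := fun j => by push_cast; ring
  simp only [hsea'] at hsea
  rw [hsea] at hmain
  simp only [IntPartition.site] at hmain
  rw [prod_siteWeight hq, ← hsize] at hmain
  have hk' : (k : ℝ) = n - c := by exact_mod_cast hk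
  have hpos :
      0 < q ^ (((∑ i ∈ Finset.range k, 0 : ℕ) : ℝ) - (k : ℝ) ^ 2 / 2 + (0 : ℤ) * k) * t ^ k :=
    mul_pos (Real.rpow_pos_of_pos hq _) (pow_pos ht _)
  refine mul_left_cancel₀ hpos.ne' (hmain.symm.trans ?_)
  rw [mul_mul_mul_comm, ← Real.rpow_add hq, ← zpow_natCast t k, ← zpow_add₀ ht.ne', hk,
    sub_add_cancel, zpow_natCast, hk']
  congr 2
  simp
  ring

theorem summable_excitationWeight {q : ℝ} (hq0 : 0 < q) (hq1 : q < 1) (t : ℝ) :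
    Summable (excitationWeight q t) := by
  have hgeom := summable_geometric_of_lt_one hq0.le hq1
  refine Summable.of_nat_of_neg_add_one ?_ ?_
  · refine (hgeom.mul_left (q ^ (1 / 2 : ℝ) * t)).congr fun n => ?_
    rw [excitationWeight, if_pos (by omega), siteWeight, Real.rpow_add hq0]
    simp
    ring
  · refine (hgeom.mul_left (q ^ (1 / 2 : ℝ) * t⁻¹)).congr fun n => ?_
    rw [excitationWeight, if_neg (by omega), siteWeight, mul_inv, ← Real.rpow_neg hq0.le,
      ← Real.rpow_natCast, mul_right_comm, ← Real.rpow_add hq0]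
    congr 2
    push_cast
    ring

open scoped Classical in
/-- The weight of a set of excitations, restricted to the configurations in which all the sites of
`B` are occupied. -/
noncomputable def occupiedWeight (q t : ℝ) (B D : Finset ℤ) : ℝ :=
  if ∀ m ∈ B, (m ∈ D ↔ 0 ≤ m) then ∏ m ∈ D, excitationWeight q t m else 0

theorem summable_occupiedWeight {q t : ℝ} (hq0 : 0 < q) (hq1 : q < 1) (ht : 0 < t)
    (B : Finset ℤ) : Summable (occupiedWeight q t B) := by
  have hnonneg (D : Finset ℤ) : 0 ≤ ∏ m ∈ D, excitationWeight q t m :=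
    Finset.prod_nonneg fun m _ => (excitationWeight_pos hq0 ht m).le
  refine Summable.of_nonneg_of_le (fun D => ?_) (fun D => ?_)
    (summable_finsetProd_of_summable_nonneg (fun m => (excitationWeight_pos hq0 ht m).le)
      (summable_excitationWeight hq0 hq1 t))
  · unfold occupiedWeight
    split_ifs
    exacts [hnonneg D, le_rfl]
  · unfold occupiedWeight
    split_ifs
    exacts [le_rfl, hnonneg D]

theorem prod_symmDiff_singleton {q t : ℝ} (hq : 0 < q) (ht : 0 < t) (a : ℤ) (D : Finset ℤ)
    (h : ¬ (a ∈ D ↔ 0 ≤ a)) :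
    siteWeight q t a * ∏ m ∈ D, excitationWeight q t m =
      ∏ m ∈ symmDiff D {a}, excitationWeight q t m := by
  have hne := (siteWeight_pos hq ht a).ne'
  by_cases ha : a ∈ D
  · have hs : symmDiff D {a} = D.erase a := by
      ext m
      simp only [Finset.mem_symmDiff, Finset.mem_singleton, Finset.mem_erase]
      grind
    rw [hs, ← Finset.mul_prod_erase D _ ha, excitationWeight, if_neg (by tauto)]
    field_simp
  · have hs : symmDiff D {a} = insert a D := by
      ext m
      simp only [Finset.mem_symmDiff, Finset.mem_singleton, Finset.mem_insert]
      grind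
    rw [hs, Finset.prod_insert ha, excitationWeight, if_pos (by tauto)]

theorem tsum_occupiedWeight_insert {q t : ℝ} (hq0 : 0 < q) (hq1 : q < 1) (ht : 0 < t)
    {a : ℤ} {B : Finset ℤ} (ha : a ∉ B) :
    ∑' D, occupiedWeight q t (insert a B) D =
      (∑' D, occupiedWeight q t B D) * (siteWeight q t a / (1 + siteWeight q t a)) := by
  have hx := siteWeight_pos hq0 ht a
  obtain ⟨σ, hσ⟩ : ∃ σ : Finset ℤ ≃ Finset ℤ, ∀ D, σ D = symmDiff D {a} :=
    ⟨Function.Involutive.toPerm (fun D => symmDiff D {a})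
      fun D => symmDiff_symmDiff_cancel_right _ _, fun _ => rfl⟩
  have hmem : ∀ (D : Finset ℤ) (m : ℤ), m ∈ σ D ↔ (m ∈ D ↔ m ≠ a) := by
    intro D m
    rw [hσ]
    simp only [Finset.mem_symmDiff, Finset.mem_singleton]
    tauto
  have hsum := summable_occupiedWeight hq0 hq1 ht (insert a B)
  have hsum' : Summable fun D => occupiedWeight q t (insert a B) (σ D) :=
    hsum.comp_injective σ.injective
  have key : ∀ D, siteWeight q t a * occupiedWeight q t B D =
      siteWeight q t a * occupiedWeight q t (insert a B) D
        + occupiedWeight q t (insert a B) (σ D) := by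
    intro D
    have hB : (∀ m ∈ B, (m ∈ σ D ↔ 0 ≤ m)) ↔ ∀ m ∈ B, (m ∈ D ↔ 0 ≤ m) := by
      refine forall₂_congr fun m hm => ?_
      have : m ≠ a := fun h => ha (h ▸ hm)
      rw [hmem]
      tauto
    have haσ : (a ∈ σ D ↔ 0 ≤ a) ↔ ¬ (a ∈ D ↔ 0 ≤ a) := by
      rw [hmem]
      tauto
    simp only [occupiedWeight, Finset.forall_mem_insert, hB, haσ]
    by_cases h : ∀ m ∈ B, (m ∈ D ↔ 0 ≤ m)
    · by_cases h' : a ∈ D ↔ 0 ≤ a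
      · simp [eq_true h, eq_true h']
      · rw [hσ, ← prod_symmDiff_singleton hq0 ht a D h']
        simp [eq_true h, eq_false h']
    · simp [h]
  have htot := tsum_congr (L := .unconditional _) key
  rw [tsum_mul_left, (hsum.mul_left _).tsum_add hsum', tsum_mul_left,
    σ.tsum_eq (occupiedWeight q t (insert a B))] at htot
  field_simp
  linarith

theorem tsum_occupiedWeight {q t : ℝ} (hq0 : 0 < q) (hq1 : q < 1) (ht : 0 < t) (B : Finset ℤ) :
    ∑' D, occupiedWeight q t B D = (∑' D, occupiedWeight q t ∅ D) *
      ∏ m ∈ B, siteWeight q t m / (1 + siteWeight q t m) := by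
  induction B using Finset.induction_on with
  | empty => simp
  | insert a B ha ih =>
    rw [tsum_occupiedWeight_insert hq0 hq1 ht ha, ih, Finset.prod_insert ha]
    ring

theorem tsum_occupiedWeight_empty_pos {q t : ℝ} (hq0 : 0 < q) (hq1 : q < 1) (ht : 0 < t) :
    0 < ∑' D, occupiedWeight q t ∅ D := by
  have hpos : ∀ D, 0 < occupiedWeight q t ∅ D := fun D => by
    simpa [occupiedWeight] using Finset.prod_pos fun m _ => excitationWeight_pos hq0 ht m
  exact (summable_occupiedWeight hq0 hq1 ht ∅).tsum_pos (fun D => (hpos D).le) ∅ (hpos ∅)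

theorem add_half_mem_shiftedS {lam : IntPartition} {c m : ℤ} :
    (m : ℝ) + 1 / 2 ∈ shiftedS lam c ↔ m ∈ Set.range (lam.site c) := by
  refine exists_congr fun i => ?_
  simp only [IntPartition.site]
  rw [← @Int.cast_inj ℝ]
  push_cast
  constructor <;> intro h <;> linarith

open scoped Classical in
theorem shift_mixed_fermi_dirac (q t : ℝ) (hq0 : 0 < q) (hq1 : q < 1) (ht : 0 < t)
    (A : Finset ℝ) (hA : (A : Set ℝ) ⊆ halfInts) :
    Summable (fun lc : IntPartition × ℤ =>
      q ^ ((lc.1.size : ℝ) + (lc.2 : ℝ) ^ 2 / 2) * t ^ lc.2) ∧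
    Summable (fun lc : IntPartition × ℤ =>
      if (A : Set ℝ) ⊆ shiftedS lc.1 lc.2 then
        q ^ ((lc.1.size : ℝ) + (lc.2 : ℝ) ^ 2 / 2) * t ^ lc.2
      else 0) ∧
    (∑' c : ℤ, ∑' lam : IntPartition,
        if (A : Set ℝ) ⊆ shiftedS lam c then
          q ^ ((lam.size : ℝ) + (c : ℝ) ^ 2 / 2) * t ^ c
        else 0) /
      (∑' c : ℤ, ∑' lam : IntPartition, q ^ ((lam.size : ℝ) + (c : ℝ) ^ 2 / 2) * t ^ c) =
      ∏ s ∈ A, (q ^ s * t) / (1 + q ^ s * t) := by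
  have hinj : Function.Injective fun m : ℤ => (m : ℝ) + 1 / 2 := fun a b h => by
    simpa using h
  obtain ⟨B, rfl⟩ : ∃ B : Finset ℤ, A = B.image fun m : ℤ => (m : ℝ) + 1 / 2 := by
    obtain ⟨B, -, hB⟩ := Finset.subset_set_image_iff.1
      (show (A : Set ℝ) ⊆ (fun m : ℤ => (m : ℝ) + 1 / 2) '' Set.univ from fun x hx => by
        obtain ⟨m, hm⟩ := hA hx
        exact ⟨m, trivial, hm.symm⟩)
    exact ⟨B, hB.symm⟩
  obtain ⟨e, he⟩ : ∃ e : IntPartition × ℤ ≃ Finset ℤ, ∀ lc, e lc = excitations lc :=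
    ⟨Equiv.ofBijective excitations ⟨excitations_injective, excitations_surjective⟩, fun _ => rfl⟩
  have hfull : (fun lc : IntPartition × ℤ =>
      q ^ ((lc.1.size : ℝ) + (lc.2 : ℝ) ^ 2 / 2) * t ^ lc.2) =
        fun lc => occupiedWeight q t ∅ (e lc) := by
    funext lc
    simpa [occupiedWeight, he] using (prod_excitationWeight hq0 ht lc.1 lc.2).symm
  have hocc : (fun lc : IntPartition × ℤ =>
      if ((B.image fun m : ℤ => (m : ℝ) + 1 / 2 : Finset ℝ) : Set ℝ) ⊆ shiftedS lc.1 lc.2 then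
        q ^ ((lc.1.size : ℝ) + (lc.2 : ℝ) ^ 2 / 2) * t ^ lc.2
      else 0) = fun lc => occupiedWeight q t B (e lc) := by
    funext lc
    have hcond : ((B.image fun m : ℤ => (m : ℝ) + 1 / 2 : Finset ℝ) : Set ℝ) ⊆
        shiftedS lc.1 lc.2 ↔ ∀ m ∈ B, (m ∈ e lc ↔ 0 ≤ m) := by
      rw [Finset.coe_image, Set.image_subset_iff]
      refine forall₂_congr fun m _ => ?_
      exact add_half_mem_shiftedS.trans (he lc ▸ mem_range_site_iff)
    simp only [hcond, occupiedWeight]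
    rw [← prod_excitationWeight hq0 ht lc.1 lc.2, he]
  have htsum : ∀ (B : Finset ℤ) (F : IntPartition × ℤ → ℝ),
      F = (fun lc => occupiedWeight q t B (e lc)) →
      Summable F ∧ ∑' c, ∑' lam, F (lam, c) = ∑' D, occupiedWeight q t B D := by
    rintro B F rfl
    have hs : Summable fun lc => occupiedWeight q t B (e lc) :=
      (summable_occupiedWeight hq0 hq1 ht B).comp_injective e.injective
    refine ⟨hs, ?_⟩
    rw [← e.tsum_eq (occupiedWeight q t B),
      ← (Equiv.prodComm ℤ IntPartition).tsum_eq fun lc => occupiedWeight q t B (e lc)]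
    exact (hs.comp_injective (Equiv.prodComm ℤ IntPartition).injective).tsum_prod.symm
  obtain ⟨hs₁, ht₁⟩ := htsum _ _ hfull
  obtain ⟨hs₂, ht₂⟩ := htsum _ _ hocc
  refine ⟨hs₁, hs₂, ?_⟩
  simp only at ht₁ ht₂
  rw [ht₁, ht₂, tsum_occupiedWeight hq0 hq1 ht B,
    mul_div_cancel_left₀ _ (tsum_occupiedWeight_empty_pos hq0 hq1 ht).ne',
    Finset.prod_image hinj.injOn]
  rfl
end
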